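/- arXiv:2110.10792 — 10 statements merged into one kernel-verified Lean document; each statement's English description precedes it below -/
import Mathlib

section
/- Let Ψ be a standard generalized risk measure taking real values. Then Ψ satisfies (A1) uncertainty aversion (Ψ(X|𝒬) ≤ Ψ(X|ℛ) for all X ∈ 𝒳 and nonempty 𝒬 ⊆ ℛ ⊆ 𝒫) and (A2) scenario monotonicity (Ψ(X|𝒬) ≤ Ψ(Y|𝒬) whenever Ψ(X|P) ≤ Ψ(Y|P) for all P ∈ 𝒬) if and only if Ψ admits the worst-case representation Ψ(X|𝒬) = sup_{P ∈ 𝒬} Ψ(X|P) for all X ∈ 𝒳 and all nonempty 𝒬 ⊆ 𝒫. -/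
open MeasureTheory Set

noncomputable section

/-- The uniform distribution on `[0,1]`. -/
def unif01 : Measure ℝ := volume.restrict (Icc (0:ℝ) 1)

/-- A probability measure is atomless (in the sense of the paper) if some measurable
real-valued map pushes it forward to the uniform distribution on `[0,1]`. -/
def IsAtomlessProb {Ω : Type*} [MeasurableSpace Ω] (P : Measure Ω) : Prop :=
  IsProbabilityMeasure P ∧ ∃ U : Ω → ℝ, Measurable U ∧ P.map U = unif01

/-- Membership in `𝒳`: bounded measurable real-valued functions. -/
def BddMeas {Ω : Type*} [MeasurableSpace Ω] (X : Ω → ℝ) : Prop :=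
  Measurable X ∧ ∃ C : ℝ, ∀ ω, |X ω| ≤ C

/-- Theorem (worst-case representation from (A1) and (A2)): a standard real-valued
generalized risk measure satisfies uncertainty aversion (A1) and scenario monotonicity (A2)
if and only if it is the worst-case (supremum) of its core. -/
theorem worst_case_representation_A1_A2 {Ω : Type*} [MeasurableSpace Ω]
    (Ψ : (Ω → ℝ) → Set (Measure Ω) → ℝ)
    (standard : ∀ (s : ℝ) (𝒬 : Set (Measure Ω)), 𝒬.Nonempty →
      𝒬 ⊆ {P | IsAtomlessProb P} → Ψ (fun _ => s) 𝒬 = s) :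
    ((∀ X : Ω → ℝ, BddMeas X → ∀ 𝒬 ℛ : Set (Measure Ω), 𝒬.Nonempty → 𝒬 ⊆ ℛ →
        ℛ ⊆ {P | IsAtomlessProb P} → Ψ X 𝒬 ≤ Ψ X ℛ) ∧
      (∀ X Y : Ω → ℝ, BddMeas X → BddMeas Y → ∀ 𝒬 : Set (Measure Ω), 𝒬.Nonempty →
        𝒬 ⊆ {P | IsAtomlessProb P} → (∀ P ∈ 𝒬, Ψ X {P} ≤ Ψ Y {P}) → Ψ X 𝒬 ≤ Ψ Y 𝒬))
    ↔
    (∀ X : Ω → ℝ, BddMeas X → ∀ 𝒬 : Set (Measure Ω), 𝒬.Nonempty →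
      𝒬 ⊆ {P | IsAtomlessProb P} →
      (Ψ X 𝒬 : EReal) = ⨆ P ∈ 𝒬, (Ψ X {P} : EReal)) := by
  constructor
  · rintro ⟨hA1, hA2⟩ X hX 𝒬 hne h𝒬
    refine le_antisymm ?_ (iSup₂_le fun P hP => EReal.coe_le_coe_iff.2
      (hA1 X hX {P} 𝒬 (singleton_nonempty P) (singleton_subset_iff.2 hP) h𝒬))
    have hle : ∀ P ∈ 𝒬, (Ψ X {P} : EReal) ≤ ⨆ P ∈ 𝒬, (Ψ X {P} : EReal) :=
      fun P hP => le_iSup₂_of_le P hP le_rfl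
    generalize (⨆ P ∈ 𝒬, (Ψ X {P} : EReal)) = b at hle ⊢
    induction b with
    | bot =>
      obtain ⟨P, hP⟩ := hne
      exact absurd (le_bot_iff.1 (hle P hP)) (EReal.coe_ne_bot _)
    | top => exact le_top
    | coe s =>
      have h := hA2 X (fun _ => s) hX ⟨measurable_const, |s|, fun _ => le_rfl⟩ 𝒬 hne h𝒬
        fun P hP => by
          rw [standard s {P} (singleton_nonempty P) (singleton_subset_iff.2 (h𝒬 hP))]
          exact EReal.coe_le_coe_iff.1 (hle P hP)
      rw [standard s 𝒬 hne h𝒬] at h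
      exact EReal.coe_le_coe_iff.2 h
  · intro h
    constructor
    · intro X hX 𝒬 ℛ hne hsub hℛ
      rw [← EReal.coe_le_coe_iff, h X hX 𝒬 hne (hsub.trans hℛ), h X hX ℛ (hne.mono hsub) hℛ]
      exact biSup_mono hsub
    · intro X Y hX hY 𝒬 hne h𝒬 hXY
      rw [← EReal.coe_le_coe_iff, h X hX 𝒬 hne h𝒬, h Y hY 𝒬 hne h𝒬]
      exact iSup₂_mono fun P hP => EReal.coe_le_coe_iff.2 (hXY P hP)
end
end

section
/- Suppose (Ω, 𝓕) is a standard Borel space. A core Ψ : 𝒳 × 𝒫 → [−∞,∞] satisfies strong law invariance (B1: Ψ(X|P) = Ψ(Y|Q) whenever X, Y ∈ 𝒳 and P, Q ∈ 𝒫 satisfy F_{X|P} = F_{Y|Q}) if and only if it satisfies both loss law invariance (B2: Ψ(X|P) = Ψ(Y|P) whenever F_{X|P} = F_{Y|P}) and scenario law invariance (B3: Ψ(X|P) = Ψ(X|Q) whenever F_{X|P} = F_{X|Q}). -/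
open MeasureTheory Set

noncomputable section

theorem IsAtomlessProb.not_countable {Ω : Type*} [MeasurableSpace Ω] {P : Measure Ω}
    (hP : IsAtomlessProb P) : ¬ Countable Ω := by
  intro hc
  obtain ⟨_, U, hU, hmap⟩ := hP
  have hr : (range U).Countable := countable_range U
  have h1 : P.map U (range U) = 1 := by
    rw [Measure.map_apply hU hr.measurableSet, preimage_range, measure_univ]
  have h0 : unif01 (range U) = 0 :=
    Measure.absolutelyContinuous_of_le Measure.restrict_le_self (hr.measure_zero volume)
  rw [hmap, h0] at h1
  exact zero_ne_one h1

theorem IsAtomlessProb.map_of_leftInverse {Ω Ω' : Type*} [MeasurableSpace Ω] [MeasurableSpace Ω']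
    {P : Measure Ω} (hP : IsAtomlessProb P) {f : Ω → Ω'} {g : Ω' → Ω} (hf : Measurable f)
    (hg : Measurable g) (hgf : Function.LeftInverse g f) : IsAtomlessProb (P.map f) := by
  obtain ⟨_, U, hU, hmap⟩ := hP
  refine ⟨Measure.isProbabilityMeasure_map hf.aemeasurable, U ∘ g, hU.comp hg, ?_⟩
  rw [Measure.map_map (hU.comp hg) hf, Function.comp_assoc, hgf.comp_eq_id, Function.comp_id, hmap]

/-- In an uncountable standard Borel space, every finite measure has a null set which is a
measurable copy of the whole space. -/
theorem exists_null_measurable_copy {Ω : Type*} [MeasurableSpace Ω] [StandardBorelSpace Ω]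
    (hΩ : ¬ Countable Ω) (S : Measure Ω) [IsFiniteMeasure S] :
    ∃ (N : Set Ω) (f g : Ω → Ω), MeasurableSet N ∧ S N = 0 ∧ Measurable f ∧ Measurable g ∧
      Function.LeftInverse g f ∧ ∀ ω, f ω ∈ N := by
  have hprod : ¬ Countable (ℝ × Ω) := fun h => hΩ <| by
    have : Function.Injective (fun ω : Ω => ((0 : ℝ), ω)) := fun a b h => (Prod.ext_iff.1 h).2
    exact this.countable
  let e : ℝ × Ω ≃ᵐ Ω := PolishSpace.measurableEquivOfNotCountable hprod hΩ
  have he : Measurable fun ω => (e.symm ω).1 := measurable_fst.comp e.symm.measurable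
  have hcount : {x : ℝ | 0 < S {ω | (e.symm ω).1 = x}}.Countable :=
    Measure.countable_meas_level_set_pos he
  obtain ⟨x, hx⟩ : ∃ x : ℝ, ¬ 0 < S {ω | (e.symm ω).1 = x} := by
    by_contra! h
    exact Cardinal.not_countable_real (hcount.mono fun x _ => h x)
  refine ⟨{ω | (e.symm ω).1 = x}, fun ω => e (x, ω), fun ω => (e.symm ω).2,
    he (measurableSet_singleton x), by simpa using hx,
    e.measurable.comp measurable_prodMk_left, measurable_snd.comp e.symm.measurable,
    fun ω => by simp, fun ω => by simp⟩

open Classical in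
theorem BddMeas.piecewise {Ω : Type*} [MeasurableSpace Ω] {X Y : Ω → ℝ} (hX : BddMeas X)
    (hY : BddMeas Y) {N : Set Ω} (hN : MeasurableSet N) : BddMeas (N.piecewise X Y) := by
  obtain ⟨hXm, C, hC⟩ := hX
  obtain ⟨hYm, D, hD⟩ := hY
  refine ⟨hXm.piecewise hN hYm, max C D, fun ω => ?_⟩
  by_cases h : ω ∈ N
  · simpa [h] using Or.inl (hC ω)
  · simpa [h] using Or.inr (hD ω)

open Classical in
theorem map_piecewise_of_null {Ω β : Type*} [MeasurableSpace Ω] [MeasurableSpace β]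
    {P : Measure Ω} {N : Set Ω} (hN : P N = 0) (X Y : Ω → β) :
    P.map (N.piecewise X Y) = P.map Y := by
  refine Measure.map_congr ?_
  filter_upwards [measure_eq_zero_iff_ae_notMem.1 hN] with ω hω
  exact piecewise_eq_of_notMem _ _ _ hω

open Classical in
theorem map_map_piecewise_of_mem {Ω β : Type*} [MeasurableSpace Ω] [MeasurableSpace β]
    {P : Measure Ω} {N : Set Ω} {f g : Ω → Ω} (hf : Measurable f)
    (hgf : Function.LeftInverse g f) (hfN : ∀ ω, f ω ∈ N) {X Y : Ω → β}
    (hm : Measurable (N.piecewise (X ∘ g) Y)) :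
    (P.map f).map (N.piecewise (X ∘ g) Y) = P.map X := by
  rw [Measure.map_map hm hf]
  congr 1
  ext ω
  simp [hfN ω, hgf ω]

/-- Theorem (equivalence of the law invariance notions on standard Borel spaces):
a core `Ψ` is strongly law invariant (B1) iff it is both loss law invariant (B2)
and scenario law invariant (B3). Here `F_{X|P}` is the pushforward `P.map X`. -/
theorem strong_law_invariance_iff_loss_and_scenario
    {Ω : Type*} [MeasurableSpace Ω] [StandardBorelSpace Ω]
    (Ψ : (Ω → ℝ) → Measure Ω → EReal) :
    (∀ X Y : Ω → ℝ, BddMeas X → BddMeas Y → ∀ P Q : Measure Ω,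
        IsAtomlessProb P → IsAtomlessProb Q → P.map X = Q.map Y → Ψ X P = Ψ Y Q)
    ↔
    ((∀ X Y : Ω → ℝ, BddMeas X → BddMeas Y → ∀ P : Measure Ω,
        IsAtomlessProb P → P.map X = P.map Y → Ψ X P = Ψ Y P) ∧
      (∀ X : Ω → ℝ, BddMeas X → ∀ P Q : Measure Ω,
        IsAtomlessProb P → IsAtomlessProb Q → P.map X = Q.map X → Ψ X P = Ψ X Q)) := by
  classical
  refine ⟨fun h => ⟨fun X Y hX hY P hP => h X Y hX hY P P hP hP,
    fun X hX P Q hP hQ => h X X hX hX P Q hP hQ⟩, ?_⟩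
  rintro ⟨hloss, hscen⟩ X Y hX hY P Q hP hQ hXY
  have : IsProbabilityMeasure P := hP.1
  have : IsProbabilityMeasure Q := hQ.1
  obtain ⟨N, f, g, hN, hPQ, hf, hg, hgf, hfN⟩ :=
    exists_null_measurable_copy hP.not_countable (P + Q)
  obtain ⟨hPN, hQN⟩ : P N = 0 ∧ Q N = 0 := by simpa using hPQ
  have hR : IsAtomlessProb (P.map f) := hP.map_of_leftInverse hf hg hgf
  have hXg : BddMeas (X ∘ g) := ⟨hX.1.comp hg, hX.2.imp fun C hC ω => hC (g ω)⟩
  have hZ : BddMeas (N.piecewise (X ∘ g) X) := hXg.piecewise hX hN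
  have hW : BddMeas (N.piecewise (X ∘ g) Y) := hXg.piecewise hY hN
  have hPZ := map_piecewise_of_null hPN (X ∘ g) X
  have hQW := map_piecewise_of_null hQN (X ∘ g) Y
  have hRZ := map_map_piecewise_of_mem (P := P) hf hgf hfN hZ.1
  have hRW := map_map_piecewise_of_mem (P := P) hf hgf hfN hW.1
  calc Ψ X P = Ψ (N.piecewise (X ∘ g) X) P := hloss _ _ hX hZ P hP hPZ.symm
    _ = Ψ (N.piecewise (X ∘ g) X) (P.map f) := hscen _ hZ _ _ hP hR (hPZ.trans hRZ.symm)
    _ = Ψ (N.piecewise (X ∘ g) Y) (P.map f) := hloss _ _ hZ hW _ hR (hRZ.trans hRW.symm)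
    _ = Ψ (N.piecewise (X ∘ g) Y) Q :=
      hscen _ hW _ _ hR hQ (hRW.trans (hXY.trans hQW.symm))
    _ = Ψ Y Q := hloss _ _ hW hY Q hQ hQW
end
end

section
/- Let Ψ be a generalized risk measure with values in [−∞,∞]. Then Ψ satisfies (A1) uncertainty aversion (Ψ(X|𝒬) ≤ Ψ(X|ℛ) whenever 𝒬 ⊆ ℛ), (A3) scenario upper bound (Ψ(X|𝒬) ≤ sup_{P∈𝒬} Ψ(X|P)), and (B1) strong law invariance (Ψ(X|P) = Ψ(Y|Q) whenever F_{X|P} = F_{Y|Q}) if and only if there exists a function ψ : ℳ → [−∞,∞] such that Ψ(X|𝒬) = sup_{P∈𝒬} ψ(F_{X|P}) for all X ∈ 𝒳 and all nonempty 𝒬 ⊆ 𝒫. -/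
open MeasureTheory Set

noncomputable section

/-- Proposition (representation under (A1), (A3) and strong law invariance (B1)):
`Ψ` satisfies (A1), (A3) and (B1) iff `Ψ(X|𝒬) = sup_{P ∈ 𝒬} ψ(F_{X|P})` for a single
functional `ψ` on distributions (a function on measures on `ℝ`; only its values on
compactly supported distributions `F_{X|P} = P.map X` matter). -/
theorem representation_A1_A3_B1 {Ω : Type*} [MeasurableSpace Ω]
    (Ψ : (Ω → ℝ) → Set (Measure Ω) → EReal) :
    ((∀ X : Ω → ℝ, BddMeas X → ∀ 𝒬 ℛ : Set (Measure Ω), 𝒬.Nonempty → 𝒬 ⊆ ℛ →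
        ℛ ⊆ {P | IsAtomlessProb P} → Ψ X 𝒬 ≤ Ψ X ℛ) ∧
      (∀ X : Ω → ℝ, BddMeas X → ∀ 𝒬 : Set (Measure Ω), 𝒬.Nonempty →
        𝒬 ⊆ {P | IsAtomlessProb P} → Ψ X 𝒬 ≤ ⨆ P ∈ 𝒬, Ψ X {P}) ∧
      (∀ X Y : Ω → ℝ, BddMeas X → BddMeas Y → ∀ P Q : Measure Ω,
        IsAtomlessProb P → IsAtomlessProb Q → P.map X = Q.map Y → Ψ X {P} = Ψ Y {Q}))
    ↔
    (∃ ψ : Measure ℝ → EReal,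
      ∀ X : Ω → ℝ, BddMeas X → ∀ 𝒬 : Set (Measure Ω), 𝒬.Nonempty →
        𝒬 ⊆ {P | IsAtomlessProb P} → Ψ X 𝒬 = ⨆ P ∈ 𝒬, ψ (P.map X)) := by
  constructor
  · rintro ⟨hA1, hA3, hB1⟩
    refine ⟨fun m => ⨆ (X : Ω → ℝ) (P : Measure Ω)
      (_ : BddMeas X ∧ IsAtomlessProb P ∧ P.map X = m), Ψ X {P}, ?_⟩
    intro X hX 𝒬 hne hsub
    have hψ : ∀ P ∈ 𝒬, (⨆ (Y : Ω → ℝ) (Q : Measure Ω)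
        (_ : BddMeas Y ∧ IsAtomlessProb Q ∧ Q.map Y = P.map X), Ψ Y {Q}) = Ψ X {P} := by
      intro P hP
      apply le_antisymm
      · refine iSup_le fun Y => iSup_le fun Q => iSup_le fun h => ?_
        exact (hB1 Y X h.1 hX Q P h.2.1 (hsub hP) h.2.2).le
      · exact le_iSup_of_le X (le_iSup_of_le P (le_iSup_of_le ⟨hX, hsub hP, rfl⟩ le_rfl))
    rw [biSup_congr hψ]
    refine le_antisymm (hA3 X hX 𝒬 hne hsub) (iSup₂_le fun P hP => ?_)
    exact hA1 X hX {P} 𝒬 (singleton_nonempty P) (singleton_subset_iff.2 hP) hsub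
  · rintro ⟨ψ, hψ⟩
    have hsingle : ∀ X : Ω → ℝ, BddMeas X → ∀ P : Measure Ω, IsAtomlessProb P →
        Ψ X {P} = ψ (P.map X) := by
      intro X hX P hP
      rw [hψ X hX {P} (singleton_nonempty P) (singleton_subset_iff.2 hP), iSup_singleton]
    refine ⟨?_, ?_, ?_⟩
    · intro X hX 𝒬 ℛ hne hsub hℛ
      rw [hψ X hX 𝒬 hne (hsub.trans hℛ), hψ X hX ℛ (hne.mono hsub) hℛ]
      exact biSup_mono fun P hP => hsub hP
    · intro X hX 𝒬 hne hsub
      rw [hψ X hX 𝒬 hne hsub]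
      exact iSup₂_mono fun P hP => (hsingle X hX P (hsub hP)).ge
    · intro X Y hX hY P Q hP hQ h
      rw [hsingle X hX P hP, hsingle Y hY Q hQ, h]
end
end

section
/- Let Ψ be a generalized risk measure with values in [−∞,∞]. Then Ψ satisfies (A1) uncertainty aversion (Ψ(X|𝒬) ≤ Ψ(X|ℛ) whenever 𝒬 ⊆ ℛ), (A3) scenario upper bound (Ψ(X|𝒬) ≤ sup_{P∈𝒬} Ψ(X|P)), and (B2) loss law invariance (Ψ(X|P) = Ψ(Y|P) whenever F_{X|P} = F_{Y|P}) if and only if there exists a family of functions ψ_P : ℳ → [−∞,∞], indexed by P ∈ 𝒫, such that Ψ(X|𝒬) = sup_{P∈𝒬} ψ_P(F_{X|P}) for all X ∈ 𝒳 and all nonempty 𝒬 ⊆ 𝒫. -/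
open MeasureTheory Set

noncomputable section

/-- Proposition (representation under (A1), (A3) and loss law invariance (B2)):
`Ψ` satisfies (A1), (A3) and (B2) iff `Ψ(X|𝒬) = sup_{P ∈ 𝒬} ψ_P(F_{X|P})` for a family
of functionals `ψ_P` on distributions indexed by the scenarios `P`. -/
theorem representation_A1_A3_B2 {Ω : Type*} [MeasurableSpace Ω]
    (Ψ : (Ω → ℝ) → Set (Measure Ω) → EReal) :
    ((∀ X : Ω → ℝ, BddMeas X → ∀ 𝒬 ℛ : Set (Measure Ω), 𝒬.Nonempty → 𝒬 ⊆ ℛ →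
        ℛ ⊆ {P | IsAtomlessProb P} → Ψ X 𝒬 ≤ Ψ X ℛ) ∧
      (∀ X : Ω → ℝ, BddMeas X → ∀ 𝒬 : Set (Measure Ω), 𝒬.Nonempty →
        𝒬 ⊆ {P | IsAtomlessProb P} → Ψ X 𝒬 ≤ ⨆ P ∈ 𝒬, Ψ X {P}) ∧
      (∀ X Y : Ω → ℝ, BddMeas X → BddMeas Y → ∀ P : Measure Ω,
        IsAtomlessProb P → P.map X = P.map Y → Ψ X {P} = Ψ Y {P}))
    ↔
    (∃ ψ : Measure Ω → Measure ℝ → EReal,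
      ∀ X : Ω → ℝ, BddMeas X → ∀ 𝒬 : Set (Measure Ω), 𝒬.Nonempty →
        𝒬 ⊆ {P | IsAtomlessProb P} → Ψ X 𝒬 = ⨆ P ∈ 𝒬, ψ P (P.map X)) := by
  constructor
  · rintro ⟨hA1, hA3, hB2⟩
    refine ⟨fun P μ => ⨆ (Y : Ω → ℝ) (_ : BddMeas Y ∧ P.map Y = μ), Ψ Y {P},
      fun X hX 𝒬 hne hsub => ?_⟩
    have key : ∀ P ∈ 𝒬, (⨆ (Y : Ω → ℝ) (_ : BddMeas Y ∧ P.map Y = P.map X), Ψ Y {P}) =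
        Ψ X {P} := fun P hP =>
      le_antisymm
        (iSup₂_le fun Y hY => (hB2 Y X hY.1 hX P (hsub hP) hY.2).le)
        (le_iSup₂_of_le X ⟨hX, rfl⟩ le_rfl)
    rw [biSup_congr key]
    exact le_antisymm (hA3 X hX 𝒬 hne hsub) <| iSup₂_le fun P hP =>
      hA1 X hX {P} 𝒬 (singleton_nonempty P) (singleton_subset_iff.2 hP) hsub
  · rintro ⟨ψ, hψ⟩
    have single : ∀ X : Ω → ℝ, BddMeas X → ∀ P : Measure Ω, IsAtomlessProb P →
        Ψ X {P} = ψ P (P.map X) := fun X hX P hP => by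
      rw [hψ X hX {P} (singleton_nonempty P) (singleton_subset_iff.2 hP), iSup_singleton]
    refine ⟨fun X hX 𝒬 ℛ hne hsub hℛ => ?_, fun X hX 𝒬 hne hsub => ?_,
      fun X Y hX hY P hP h => ?_⟩
    · rw [hψ X hX 𝒬 hne (hsub.trans hℛ), hψ X hX ℛ (hne.mono hsub) hℛ]
      exact biSup_mono hsub
    · rw [hψ X hX 𝒬 hne hsub]
      exact iSup₂_mono fun P hP => (single X hX P (hsub hP)).ge
    · rw [single X hX P hP, single Y hY P hP, h]
end
end

section
/- Let Ψ be a generalized risk measure with values in [−∞,∞]. Then Ψ satisfies (A1) uncertainty aversion (Ψ(X|𝒬) ≤ Ψ(X|ℛ) whenever 𝒬 ⊆ ℛ), (A3) scenario upper bound (Ψ(X|𝒬) ≤ sup_{P∈𝒬} Ψ(X|P)), and (B3) scenario law invariance (Ψ(X|P) = Ψ(X|Q) whenever F_{X|P} = F_{X|Q}) if and only if there exists a family of functions ψ_X : ℳ → [−∞,∞], indexed by X ∈ 𝒳, such that Ψ(X|𝒬) = sup_{P∈𝒬} ψ_X(F_{X|P}) for all X ∈ 𝒳 and all nonempty 𝒬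 ⊆ 𝒫. -/
open MeasureTheory Set

noncomputable section

/-- Proposition (representation under (A1), (A3) and scenario law invariance (B3)):
`Ψ` satisfies (A1), (A3) and (B3) iff `Ψ(X|𝒬) = sup_{P ∈ 𝒬} ψ_X(F_{X|P})` for a family
of functionals `ψ_X` on distributions indexed by the random losses `X`. -/
theorem representation_A1_A3_B3 {Ω : Type*} [MeasurableSpace Ω]
    (Ψ : (Ω → ℝ) → Set (Measure Ω) → EReal) :
    ((∀ X : Ω → ℝ, BddMeas X → ∀ 𝒬 ℛ : Set (Measure Ω), 𝒬.Nonempty → 𝒬 ⊆ ℛ →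
        ℛ ⊆ {P | IsAtomlessProb P} → Ψ X 𝒬 ≤ Ψ X ℛ) ∧
      (∀ X : Ω → ℝ, BddMeas X → ∀ 𝒬 : Set (Measure Ω), 𝒬.Nonempty →
        𝒬 ⊆ {P | IsAtomlessProb P} → Ψ X 𝒬 ≤ ⨆ P ∈ 𝒬, Ψ X {P}) ∧
      (∀ X : Ω → ℝ, BddMeas X → ∀ P Q : Measure Ω,
        IsAtomlessProb P → IsAtomlessProb Q → P.map X = Q.map X → Ψ X {P} = Ψ X {Q}))
    ↔
    (∃ ψ : (Ω → ℝ) → Measure ℝ → EReal,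
      ∀ X : Ω → ℝ, BddMeas X → ∀ 𝒬 : Set (Measure Ω), 𝒬.Nonempty →
        𝒬 ⊆ {P | IsAtomlessProb P} → Ψ X 𝒬 = ⨆ P ∈ 𝒬, ψ X (P.map X)) := by
  constructor
  · rintro ⟨hmono, hupper, hlaw⟩
    refine ⟨fun X m => ⨆ P ∈ {P : Measure Ω | IsAtomlessProb P ∧ P.map X = m}, Ψ X {P}, ?_⟩
    intro X hX 𝒬 hne h𝒬
    have hψ : ∀ P ∈ 𝒬, (⨆ P' ∈ {P' : Measure Ω | IsAtomlessProb P' ∧ P'.map X = P.map X},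
        Ψ X {P'}) = Ψ X {P} := fun P hP =>
      le_antisymm (iSup₂_le fun P' hP' => (hlaw X hX P' P hP'.1 (h𝒬 hP) hP'.2).le)
        (le_iSup₂_of_le P ⟨h𝒬 hP, rfl⟩ le_rfl)
    refine Eq.trans ?_ (biSup_congr hψ).symm
    exact le_antisymm (hupper X hX 𝒬 hne h𝒬) (iSup₂_le fun P hP =>
      hmono X hX {P} 𝒬 (singleton_nonempty P) (singleton_subset_iff.2 hP) h𝒬)
  · rintro ⟨ψ, hψ⟩
    have hsingle : ∀ X : Ω → ℝ, BddMeas X → ∀ P : Measure Ω, IsAtomlessProb P →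
        Ψ X {P} = ψ X (P.map X) := fun X hX P hP => by
      rw [hψ X hX {P} (singleton_nonempty P) (singleton_subset_iff.2 hP), iSup_singleton]
    refine ⟨fun X hX 𝒬 ℛ hne hsub hℛ => ?_, fun X hX 𝒬 hne h𝒬 => ?_,
      fun X hX P Q hP hQ hPQ => ?_⟩
    · rw [hψ X hX 𝒬 hne (hsub.trans hℛ), hψ X hX ℛ (hne.mono hsub) hℛ]
      exact biSup_mono hsub
    · rw [hψ X hX 𝒬 hne h𝒬]
      exact iSup₂_mono fun P hP => (hsingle X hX P (h𝒬 hP)).ge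
    · rw [hsingle X hX P hP, hsingle X hX Q hQ, hPQ]
end
end

section
/- Let Ψ be a standard generalized risk measure taking real values. Then Ψ satisfies (A1) uncertainty aversion (Ψ(X|𝒬) ≤ Ψ(X|ℛ) whenever 𝒬 ⊆ ℛ), (A2) scenario monotonicity (Ψ(X|𝒬) ≤ Ψ(Y|𝒬) whenever Ψ(X|P) ≤ Ψ(Y|P) for all P ∈ 𝒬), (B2) loss law invariance (Ψ(X|P) = Ψ(Y|P) whenever F_{X|P} = F_{Y|P}), (C1) monotonicity (X ≤ Y pointwise implies Ψ(X|𝒬) ≤ Ψ(Y|𝒬) for every nonempty 𝒬), and (C0) additivity of the core (Ψ(X+Y|P) = Ψ(X|P) + Ψ(Y|P) for all X, Y ∈ 𝒳 and P ∈ 𝒫) if and only if Ψ(X|𝒬) = sup_{P∈𝒬} ∫ X dP for all X ∈ 𝒳 and nonempty 𝒬 ⊆ 𝒫. Moreover, the map Ψ(X|𝒬) = sup_{P∈𝒬} ∫ X dP satisfies, for every fixed nonempty 𝒬: cash-additivity (Ψ(X+m|𝒬) = Ψ(X|𝒬) + m for all m ∈ ℝ), positive homogeneity (Ψ(λX|𝒬)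 = λΨ(X|𝒬) for all λ > 0), and subadditivity (Ψ(X+Y|𝒬) ≤ Ψ(X|𝒬) + Ψ(Y|𝒬)). -/
open MeasureTheory Set

noncomputable section

lemma eq_of_forall_abs_nat_mul_sub_le {a b : ℝ} (h : ∀ n : ℕ, |n * a - n * b| ≤ 1) : a = b := by
  by_contra hne
  have hpos : 0 < |a - b| := abs_pos.mpr (sub_ne_zero.mpr hne)
  obtain ⟨n, hn⟩ := exists_nat_gt (1 / |a - b|)
  have h1 := h n
  rw [← mul_sub, abs_mul, Nat.abs_cast] at h1
  rw [div_lt_iff₀ hpos] at hn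
  linarith

section BddMeas

variable {Ω : Type*} [MeasurableSpace Ω] {X Y : Ω → ℝ}

lemma bddMeas_const (s : ℝ) : BddMeas (fun _ : Ω => s) :=
  ⟨measurable_const, |s|, fun _ => le_rfl⟩

lemma BddMeas.add (hX : BddMeas X) (hY : BddMeas Y) : BddMeas (fun ω => X ω + Y ω) := by
  obtain ⟨C, hC⟩ := hX.2
  obtain ⟨D, hD⟩ := hY.2
  exact ⟨hX.1.add hY.1, C + D, fun ω => (abs_add_le _ _).trans (add_le_add (hC ω) (hD ω))⟩

lemma BddMeas.finset_sum {ι : Type*} (s : Finset ι) {f : ι → Ω → ℝ}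
    (hf : ∀ i ∈ s, BddMeas (f i)) : BddMeas (fun ω => ∑ i ∈ s, f i ω) := by
  classical
  induction s using Finset.induction_on with
  | empty => simpa using bddMeas_const (Ω := Ω) 0
  | insert a s ha ih =>
    simp only [Finset.sum_insert ha]
    exact (hf a (by simp)).add (ih fun i hi => hf i (by simp [hi]))

lemma BddMeas.integrable (hX : BddMeas X) (P : Measure Ω) [IsFiniteMeasure P] :
    Integrable X P := by
  obtain ⟨C, hC⟩ := hX.2
  exact Integrable.of_bound hX.1.aestronglyMeasurable C (Filter.Eventually.of_forall hC)

lemma bddMeas_indicator_one {A : Set Ω} (hA : MeasurableSet A) :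
    BddMeas (A.indicator (fun _ => (1 : ℝ))) := by
  classical
  refine ⟨measurable_const.indicator hA, 1, fun ω => ?_⟩
  by_cases h : ω ∈ A <;> simp [h]

lemma map_indicator_one_eq {P : Measure Ω} [IsProbabilityMeasure P] {A B : Set Ω}
    (hA : MeasurableSet A) (hB : MeasurableSet B) (h : P.real A = P.real B) :
    P.map (A.indicator (fun _ => (1 : ℝ))) = P.map (B.indicator (fun _ => (1 : ℝ))) := by
  classical
  have hAB : P A = P B := (measureReal_eq_measureReal_iff).mp h
  have hc : P Aᶜ = P Bᶜ := by
    rw [prob_compl_eq_one_sub hA, prob_compl_eq_one_sub hB, hAB]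
  ext s hs
  rw [Measure.map_apply (measurable_const.indicator hA) hs,
    Measure.map_apply (measurable_const.indicator hB) hs]
  rw [Set.indicator_const_preimage_eq_union, Set.indicator_const_preimage_eq_union]
  by_cases h1 : (1 : ℝ) ∈ s <;> by_cases h0 : (0 : ℝ) ∈ s <;> simp [h1, h0, hAB, hc]

end BddMeas

/-- A law-invariant, monotone and additive functional on bounded measurable functions that fixes
the constants. -/
structure IsLawInvariantMean {Ω : Type*} [MeasurableSpace Ω] (P : Measure Ω)
    (φ : (Ω → ℝ) → ℝ) : Prop where
  map_const : ∀ s : ℝ, φ (fun _ => s) = s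
  eq_of_map_eq : ∀ X Y, BddMeas X → BddMeas Y → P.map X = P.map Y → φ X = φ Y
  mono : ∀ X Y, BddMeas X → BddMeas Y → (∀ ω, X ω ≤ Y ω) → φ X ≤ φ Y
  map_add : ∀ X Y, BddMeas X → BddMeas Y → φ (fun ω => X ω + Y ω) = φ X + φ Y

lemma integral_floor_sub_floor (a p : ℝ) :
    ∫ u, ((⌊u - a⌋ : ℝ) - ⌊u - a - p⌋) ∂unif01 = p := by
  have hint : ∀ c : ℝ, IntervalIntegrable (fun u : ℝ => Int.fract (u - c)) volume 0 1 := by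
    intro c
    rw [intervalIntegrable_iff_integrableOn_Ioc_of_le zero_le_one]
    refine Integrable.of_bound (measurable_fract.comp
      (measurable_id.sub_const c)).aestronglyMeasurable 1 (Filter.Eventually.of_forall fun u => ?_)
    rw [Real.norm_eq_abs, abs_of_nonneg (Int.fract_nonneg _)]
    exact (Int.fract_lt_one _).le
  have hper : ∀ c : ℝ, ∫ u in (0 : ℝ)..1, Int.fract (u - c) = ∫ u in (0 : ℝ)..1, Int.fract u := by
    intro c
    rw [intervalIntegral.integral_comp_sub_right (fun u => Int.fract u)]
    have h := (Int.fract_periodic ℝ).intervalIntegral_add_eq (0 - c) 0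
    rwa [show (0 - c + 1 : ℝ) = 1 - c by ring, zero_add] at h
  have hfun : ∀ u : ℝ, ((⌊u - a⌋ : ℝ) - ⌊u - a - p⌋)
      = p + (Int.fract (u - (a + p)) - Int.fract (u - a)) := by
    intro u
    rw [Int.fract, Int.fract, sub_sub u a p]
    ring
  simp only [hfun]
  rw [unif01, integral_Icc_eq_integral_Ioc, ← intervalIntegral.integral_of_le zero_le_one,
    intervalIntegral.integral_add (by simp) ((hint _).sub (hint _)),
    intervalIntegral.integral_sub (hint _) (hint _), hper, hper]
  simp

/-- The points `u` such that `⌊u - a⌋` exceeds `⌊u - a - p⌋`. -/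
def floorJump (a p : ℝ) : Set ℝ := {u | ⌊u - a⌋ - ⌊u - a - p⌋ = 1}

lemma measurableSet_floorJump (a p : ℝ) : MeasurableSet (floorJump a p) :=
  measurableSet_eq_fun ((Int.measurable_floor.comp (measurable_id.sub_const a)).sub
    (Int.measurable_floor.comp ((measurable_id.sub_const a).sub_const p))) measurable_const

lemma indicator_floorJump {p : ℝ} (hp0 : 0 ≤ p) (hp1 : p ≤ 1) (a u : ℝ) :
    (floorJump a p).indicator (fun _ => (1 : ℝ)) u = (⌊u - a⌋ : ℝ) - ⌊u - a - p⌋ := by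
  have h1 : ⌊u - a - p⌋ ≤ ⌊u - a⌋ := Int.floor_le_floor (by linarith)
  have h2 : ⌊u - a⌋ ≤ ⌊u - a - p⌋ + 1 := by
    rw [← Int.floor_add_one]
    exact Int.floor_le_floor (by linarith)
  rw [← Int.cast_sub]
  by_cases h : ⌊u - a⌋ - ⌊u - a - p⌋ = 1
  · rw [Set.indicator_of_mem (show u ∈ floorJump a p from h), h, Int.cast_one]
  · rw [Set.indicator_of_notMem (show u ∉ floorJump a p from h),
      show ⌊u - a⌋ - ⌊u - a - p⌋ = 0 by omega, Int.cast_zero]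

lemma measureReal_preimage_floorJump {Ω : Type*} [MeasurableSpace Ω] {P : Measure Ω}
    {U : Ω → ℝ} (hU : Measurable U) (hUP : P.map U = unif01) {p : ℝ}
    (hp0 : 0 ≤ p) (hp1 : p ≤ 1) (a : ℝ) : P.real (U ⁻¹' floorJump a p) = p := by
  rw [← map_measureReal_apply hU (measurableSet_floorJump a p), hUP,
    ← integral_indicator_one (measurableSet_floorJump a p)]
  refine Eq.trans (integral_congr_ae (Filter.Eventually.of_forall fun u => ?_))
    (integral_floor_sub_floor a p)
  exact indicator_floorJump hp0 hp1 a u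

namespace IsLawInvariantMean

variable {Ω : Type*} [MeasurableSpace Ω] {P : Measure Ω} {φ : (Ω → ℝ) → ℝ}

lemma map_finset_sum (hφ : IsLawInvariantMean P φ) {ι : Type*} (s : Finset ι) {f : ι → Ω → ℝ}
    (hf : ∀ i ∈ s, BddMeas (f i)) : φ (fun ω => ∑ i ∈ s, f i ω) = ∑ i ∈ s, φ (f i) := by
  classical
  induction s using Finset.induction_on with
  | empty => simpa using hφ.map_const 0
  | insert a s ha ih =>
    have hs : ∀ i ∈ s, BddMeas (f i) := fun i hi => hf i (by simp [hi])
    simp only [Finset.sum_insert ha]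
    rw [hφ.map_add _ _ (hf a (by simp)) (BddMeas.finset_sum s hs), ih hs]

lemma map_nat_mul (hφ : IsLawInvariantMean P φ) (n : ℕ) {X : Ω → ℝ} (hX : BddMeas X) :
    φ (fun ω => n * X ω) = n * φ X := by
  simpa using hφ.map_finset_sum (Finset.range n) (f := fun _ => X) fun _ _ => hX

lemma map_indicator (hφ : IsLawInvariantMean P φ) (hP : IsAtomlessProb P) {A : Set Ω}
    (hA : MeasurableSet A) : φ (A.indicator fun _ => (1 : ℝ)) = P.real A := by
  obtain ⟨hprob, U, hU, hUP⟩ := hP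
  set p := P.real A with hp
  have hp0 : 0 ≤ p := measureReal_nonneg
  have hp1 : p ≤ 1 := measureReal_le_one
  refine eq_of_forall_abs_nat_mul_sub_le fun n => ?_
  let B : ℕ → Set Ω := fun k => U ⁻¹' floorJump (k * p) p
  have hB : ∀ k, MeasurableSet (B k) := fun k => hU (measurableSet_floorJump _ _)
  have hBA : ∀ k, φ ((B k).indicator fun _ => (1 : ℝ)) = φ (A.indicator fun _ => (1 : ℝ)) :=
    fun k => hφ.eq_of_map_eq _ _ (bddMeas_indicator_one (hB k)) (bddMeas_indicator_one hA)
      (map_indicator_one_eq (hB k) hA (measureReal_preimage_floorJump hU hUP hp0 hp1 _))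
  have hbdd := BddMeas.finset_sum (Finset.range n) fun k _ => bddMeas_indicator_one (hB k)
  have hsum := hφ.map_finset_sum (Finset.range n) fun k _ => bddMeas_indicator_one (hB k)
  simp only [hBA, Finset.sum_const, Finset.card_range, nsmul_eq_mul] at hsum
  have htel : ∀ ω, ∑ k ∈ Finset.range n, (B k).indicator (fun _ => (1 : ℝ)) ω
      = (⌊U ω⌋ : ℝ) - ⌊U ω - n * p⌋ := by
    intro ω
    have hk : ∀ k : ℕ, (B k).indicator (fun _ => (1 : ℝ)) ω
        = (⌊U ω - k * p⌋ : ℝ) - ⌊U ω - (k + 1 : ℕ) * p⌋ := by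
      intro k
      have h := indicator_floorJump hp0 hp1 (k * p) (U ω)
      rw [show U ω - k * p - p = U ω - (k + 1 : ℕ) * p by push_cast; ring] at h
      exact h
    rw [Finset.sum_congr rfl fun k _ => hk k,
      Finset.sum_range_sub' (fun k : ℕ => (⌊U ω - k * p⌋ : ℝ))]
    simp
  rw [← hsum, abs_le]
  have hlow := hφ.mono _ _ (bddMeas_const (n * p - 1)) hbdd fun ω => by
    rw [htel]
    linarith [Int.sub_one_lt_floor (U ω), Int.floor_le (U ω - n * p)]
  have hup := hφ.mono _ _ hbdd (bddMeas_const (n * p + 1)) fun ω => by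
    rw [htel]
    linarith [Int.sub_one_lt_floor (U ω - n * p), Int.floor_le (U ω)]
  rw [hφ.map_const] at hlow hup
  constructor <;> linarith

lemma natFloor_eq_sum {x : ℝ} {M : ℕ} (hM : x ≤ M) :
    (⌊x⌋₊ : ℝ) = ∑ k ∈ Finset.range M, if (k : ℝ) + 1 ≤ x then (1 : ℝ) else 0 := by
  rw [Finset.sum_boole]
  congr 1
  rw [← Finset.card_range ⌊x⌋₊]
  congr 1
  ext k
  simp only [Finset.mem_range, Finset.mem_filter]
  rw [← Nat.succ_le_iff, Nat.le_floor_iff' (Nat.succ_ne_zero k)]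
  push_cast
  refine ⟨fun h => ⟨?_, h⟩, fun h => h.2⟩
  have : (k : ℝ) < M := by linarith
  exact_mod_cast this

lemma map_natFloor (hφ : IsLawInvariantMean P φ) (hP : IsAtomlessProb P) {X : Ω → ℝ}
    (hX : BddMeas X) :
    BddMeas (fun ω => (⌊X ω⌋₊ : ℝ)) ∧
      φ (fun ω => (⌊X ω⌋₊ : ℝ)) = ∫ ω, (⌊X ω⌋₊ : ℝ) ∂P := by
  classical
  have := hP.1
  obtain ⟨C, hC⟩ := hX.2
  obtain ⟨M, hM⟩ := exists_nat_ge C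
  have hA : ∀ k : ℕ, MeasurableSet {ω | (k : ℝ) + 1 ≤ X ω} :=
    fun k => measurableSet_le measurable_const hX.1
  have heq : (fun ω => (⌊X ω⌋₊ : ℝ)) = fun ω => ∑ k ∈ Finset.range M,
      {ω | (k : ℝ) + 1 ≤ X ω}.indicator (fun _ => (1 : ℝ)) ω := by
    ext ω
    rw [natFloor_eq_sum ((le_abs_self _).trans ((hC ω).trans hM))]
    simp [Set.indicator_apply]
  rw [heq]
  refine ⟨BddMeas.finset_sum _ fun k _ => bddMeas_indicator_one (hA k), ?_⟩
  rw [hφ.map_finset_sum _ fun k _ => bddMeas_indicator_one (hA k),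
    integral_finsetSum _ fun k _ => (bddMeas_indicator_one (hA k)).integrable P]
  refine Finset.sum_congr rfl fun k _ => ?_
  rw [hφ.map_indicator hP (hA k)]
  exact (integral_indicator_one (hA k)).symm

lemma eq_integral_of_nonneg (hφ : IsLawInvariantMean P φ) (hP : IsAtomlessProb P) {X : Ω → ℝ}
    (hX : BddMeas X) (h0 : ∀ ω, 0 ≤ X ω) : φ X = ∫ ω, X ω ∂P := by
  have := hP.1
  refine eq_of_forall_abs_nat_mul_sub_le fun n => ?_
  have hnX : BddMeas (fun ω => n * X ω) := by
    simpa using BddMeas.finset_sum (Finset.range n) (f := fun _ => X) fun _ _ => hX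
  obtain ⟨hfl, hflφ⟩ := hφ.map_natFloor hP hnX
  have hnn : ∀ ω, 0 ≤ n * X ω := fun ω => mul_nonneg n.cast_nonneg (h0 ω)
  have hle : ∀ ω, (⌊n * X ω⌋₊ : ℝ) ≤ n * X ω := fun ω => Nat.floor_le (hnn ω)
  have hlt : ∀ ω, n * X ω ≤ ⌊n * X ω⌋₊ + 1 := fun ω => (Nat.lt_floor_add_one _).le
  have h1 := hφ.mono _ _ hfl hnX hle
  have h2 := hφ.mono _ _ hnX (hfl.add (bddMeas_const 1)) hlt
  have h3 := integral_mono (hfl.integrable P) (hnX.integrable P) hle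
  have h4 := integral_mono (hnX.integrable P) ((hfl.add (bddMeas_const 1)).integrable P) hlt
  rw [hφ.map_add _ _ hfl (bddMeas_const 1), hφ.map_const, hφ.map_nat_mul n hX] at h2
  rw [hφ.map_nat_mul n hX] at h1
  rw [integral_add (hfl.integrable P) (integrable_const 1), integral_const_mul] at h4
  simp only [integral_const_mul] at h3
  simp only [integral_const, probReal_univ, smul_eq_mul, mul_one] at h4
  rw [abs_le]
  constructor <;> linarith

lemma eq_integral (hφ : IsLawInvariantMean P φ) (hP : IsAtomlessProb P) {X : Ω → ℝ}
    (hX : BddMeas X) : φ X = ∫ ω, X ω ∂P := by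
  have := hP.1
  obtain ⟨C, hC⟩ := hX.2
  have h := hφ.eq_integral_of_nonneg hP (hX.add (bddMeas_const C))
    fun ω => by linarith [(abs_le.mp (hC ω)).1]
  rw [hφ.map_add _ _ hX (bddMeas_const C), hφ.map_const,
    integral_add (hX.integrable P) (integrable_const C)] at h
  simpa using h

end IsLawInvariantMean

section WorstCase

variable {Ω : Type*} [MeasurableSpace Ω] {𝒬 : Set (Measure Ω)}

lemma exists_isLUB_integral (hne : 𝒬.Nonempty) (hQ : 𝒬 ⊆ {P | IsAtomlessProb P}) {X : Ω → ℝ}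
    (hX : BddMeas X) : ∃ S : ℝ, IsLUB ((fun P => ∫ ω, X ω ∂P) '' 𝒬) S := by
  obtain ⟨C, hC⟩ := hX.2
  refine ⟨_, isLUB_csSup (hne.image _) ⟨C, ?_⟩⟩
  rintro _ ⟨P, hP, rfl⟩
  have := (hQ hP).1
  have h := integral_mono (hX.integrable P) (integrable_const C)
    fun ω => (le_abs_self _).trans (hC ω)
  simpa using h

lemma biSup_coe_eq_of_isLUB (hne : 𝒬.Nonempty) {f : Measure Ω → ℝ} {S : ℝ}
    (h : IsLUB (f '' 𝒬) S) : (⨆ P ∈ 𝒬, (f P : EReal)) = S := by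
  refine le_antisymm (iSup₂_le fun P hP => EReal.coe_le_coe_iff.mpr (h.1 ⟨P, hP, rfl⟩)) ?_
  obtain ⟨P, hP⟩ := hne
  have hle : ∀ R ∈ 𝒬, (f R : EReal) ≤ ⨆ P ∈ 𝒬, (f P : EReal) :=
    fun R hR => le_iSup₂ (f := fun P (_ : P ∈ 𝒬) => (f P : EReal)) R hR
  generalize (⨆ P ∈ 𝒬, (f P : EReal)) = t at hle
  induction t with
  | bot => exact absurd (hle P hP) (by simp)
  | top => exact le_top
  | coe t =>
    refine EReal.coe_le_coe_iff.mpr (h.2 ?_)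
    rintro _ ⟨R, hR, rfl⟩
    exact EReal.coe_le_coe_iff.mp (hle R hR)

end WorstCase

/-- Theorem (characterization of the worst-case expectation): a standard real-valued
generalized risk measure satisfies (A1), (A2), (B2), (C1) and (C0) iff
`Ψ(X|𝒬) = sup_{P∈𝒬} E^P[X]`; moreover the worst-case expectation is cash-additive,
positively homogeneous, and subadditive in the loss for every fixed nonempty `𝒬 ⊆ 𝒫`. -/
theorem coherent_characterization {Ω : Type*} [MeasurableSpace Ω]
    (Ψ : (Ω → ℝ) → Set (Measure Ω) → ℝ)
    (standard : ∀ (s : ℝ) (𝒬 : Set (Measure Ω)), 𝒬.Nonempty →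
      𝒬 ⊆ {P | IsAtomlessProb P} → Ψ (fun _ => s) 𝒬 = s) :
    (((∀ X : Ω → ℝ, BddMeas X → ∀ 𝒬 ℛ : Set (Measure Ω), 𝒬.Nonempty → 𝒬 ⊆ ℛ →
          ℛ ⊆ {P | IsAtomlessProb P} → Ψ X 𝒬 ≤ Ψ X ℛ) ∧
        (∀ X Y : Ω → ℝ, BddMeas X → BddMeas Y → ∀ 𝒬 : Set (Measure Ω), 𝒬.Nonempty →
          𝒬 ⊆ {P | IsAtomlessProb P} → (∀ P ∈ 𝒬, Ψ X {P} ≤ Ψ Y {P}) → Ψ X 𝒬 ≤ Ψ Y 𝒬) ∧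
        (∀ X Y : Ω → ℝ, BddMeas X → BddMeas Y → ∀ P : Measure Ω, IsAtomlessProb P →
          P.map X = P.map Y → Ψ X {P} = Ψ Y {P}) ∧
        (∀ X Y : Ω → ℝ, BddMeas X → BddMeas Y → (∀ ω, X ω ≤ Y ω) →
          ∀ 𝒬 : Set (Measure Ω), 𝒬.Nonempty → 𝒬 ⊆ {P | IsAtomlessProb P} →
          Ψ X 𝒬 ≤ Ψ Y 𝒬) ∧
        (∀ X Y : Ω → ℝ, BddMeas X → BddMeas Y → ∀ P : Measure Ω, IsAtomlessProb P →
          Ψ (fun ω => X ω + Y ω) {P} = Ψ X {P} + Ψ Y {P}))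
      ↔
      (∀ X : Ω → ℝ, BddMeas X → ∀ 𝒬 : Set (Measure Ω), 𝒬.Nonempty →
        𝒬 ⊆ {P | IsAtomlessProb P} →
        (Ψ X 𝒬 : EReal) = ⨆ P ∈ 𝒬, ((∫ ω, X ω ∂P : ℝ) : EReal)))
    ∧
    -- Moreover, the worst-case expectation satisfies (C2)-(C4):
    (∀ (𝒬 : Set (Measure Ω)), 𝒬.Nonempty → 𝒬 ⊆ {P | IsAtomlessProb P} →
      ∀ X Y : Ω → ℝ, BddMeas X → BddMeas Y →
      (∀ m : ℝ, (⨆ P ∈ 𝒬, ((∫ ω, X ω + m ∂P : ℝ) : EReal)) =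
        (⨆ P ∈ 𝒬, ((∫ ω, X ω ∂P : ℝ) : EReal)) + (m : EReal)) ∧
      (∀ l : ℝ, 0 < l → (⨆ P ∈ 𝒬, ((∫ ω, l * X ω ∂P : ℝ) : EReal)) =
        (l : EReal) * ⨆ P ∈ 𝒬, ((∫ ω, X ω ∂P : ℝ) : EReal)) ∧
      ((⨆ P ∈ 𝒬, ((∫ ω, X ω + Y ω ∂P : ℝ) : EReal)) ≤
        (⨆ P ∈ 𝒬, ((∫ ω, X ω ∂P : ℝ) : EReal)) +
          ⨆ P ∈ 𝒬, ((∫ ω, Y ω ∂P : ℝ) : EReal))) := by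
  refine ⟨⟨?_, ?_⟩, ?_⟩
  · rintro ⟨hA1, hA2, hB2, hC1, hC0⟩ X hX 𝒬 hne hQ
    have hsing : ∀ P, IsAtomlessProb P → Ψ X {P} = ∫ ω, X ω ∂P := fun P hP =>
      IsLawInvariantMean.eq_integral (φ := fun X => Ψ X {P})
        ⟨fun s => standard s {P} (singleton_nonempty P) (singleton_subset_iff.mpr hP),
          fun X Y hX hY h => hB2 X Y hX hY P hP h,
          fun X Y hX hY h => hC1 X Y hX hY h {P} (singleton_nonempty P)
            (singleton_subset_iff.mpr hP),
          fun X Y hX hY => hC0 X Y hX hY P hP⟩ hP hX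
    obtain ⟨S, hS⟩ := exists_isLUB_integral hne hQ hX
    rw [biSup_coe_eq_of_isLUB hne hS, EReal.coe_eq_coe_iff]
    refine le_antisymm ?_ (hS.2 ?_)
    · rw [← standard S 𝒬 hne hQ]
      refine hA2 X _ hX (bddMeas_const S) 𝒬 hne hQ fun P hP => ?_
      rw [hsing P (hQ hP), standard S {P} (singleton_nonempty P)
        (singleton_subset_iff.mpr (hQ hP))]
      exact hS.1 ⟨P, hP, rfl⟩
    · rintro _ ⟨P, hP, rfl⟩
      change ∫ ω, X ω ∂P ≤ _
      rw [← hsing P (hQ hP)]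
      exact hA1 X hX {P} 𝒬 (singleton_nonempty P) (singleton_subset_iff.mpr hP) hQ
  · intro h
    have hsing : ∀ X, BddMeas X → ∀ P, IsAtomlessProb P → Ψ X {P} = ∫ ω, X ω ∂P := by
      intro X hX P hP
      have := h X hX {P} (singleton_nonempty P) (singleton_subset_iff.mpr hP)
      simpa using this
    have hA2 : ∀ X Y : Ω → ℝ, BddMeas X → BddMeas Y → ∀ 𝒬 : Set (Measure Ω), 𝒬.Nonempty →
        𝒬 ⊆ {P | IsAtomlessProb P} → (∀ P ∈ 𝒬, Ψ X {P} ≤ Ψ Y {P}) → Ψ X 𝒬 ≤ Ψ Y 𝒬 := by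
      intro X Y hX hY 𝒬 hne hQ hle
      rw [← EReal.coe_le_coe_iff, h X hX 𝒬 hne hQ, h Y hY 𝒬 hne hQ]
      refine iSup₂_mono fun P hP => EReal.coe_le_coe_iff.mpr ?_
      rw [← hsing X hX P (hQ hP), ← hsing Y hY P (hQ hP)]
      exact hle P hP
    refine ⟨?_, hA2, ?_, ?_, ?_⟩
    · intro X hX 𝒬 ℛ hne hsub hR
      rw [← EReal.coe_le_coe_iff, h X hX 𝒬 hne (hsub.trans hR), h X hX ℛ (hne.mono hsub) hR]
      exact biSup_mono hsub
    · intro X Y hX hY P hP hlaw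
      rw [hsing X hX P hP, hsing Y hY P hP,
        ← integral_map hX.1.aemeasurable (f := fun x => x) aestronglyMeasurable_id, hlaw,
        integral_map hY.1.aemeasurable (f := fun x => x) aestronglyMeasurable_id]
    · intro X Y hX hY hle 𝒬 hne hQ
      refine hA2 X Y hX hY 𝒬 hne hQ fun P hP => ?_
      have := (hQ hP).1
      rw [hsing X hX P (hQ hP), hsing Y hY P (hQ hP)]
      exact integral_mono (hX.integrable P) (hY.integrable P) hle
    · intro X Y hX hY P hP
      have := hP.1
      rw [hsing X hX P hP, hsing Y hY P hP, hsing _ (hX.add hY) P hP]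
      exact integral_add (hX.integrable P) (hY.integrable P)
  · intro 𝒬 hne hQ X Y hX hY
    obtain ⟨S, hS⟩ := exists_isLUB_integral hne hQ hX
    obtain ⟨T, hT⟩ := exists_isLUB_integral hne hQ hY
    rw [biSup_coe_eq_of_isLUB hne hS, biSup_coe_eq_of_isLUB hne hT]
    refine ⟨fun m => ?_, fun l hl => ?_, ?_⟩
    · rw [← EReal.coe_add]
      have hadd : ∀ P ∈ 𝒬, ∫ ω, X ω + m ∂P = ∫ ω, X ω ∂P + m := by
        intro P hP
        have := (hQ hP).1
        rw [integral_add (hX.integrable P) (integrable_const m)]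
        simp
      refine biSup_coe_eq_of_isLUB hne ⟨?_, fun b hb => ?_⟩
      · rintro _ ⟨P, hP, rfl⟩
        change ∫ ω, X ω + m ∂P ≤ _
        rw [hadd P hP]
        linarith [hS.1 ⟨P, hP, rfl⟩]
      · rw [← le_sub_iff_add_le]
        refine hS.2 ?_
        rintro _ ⟨P, hP, rfl⟩
        rw [le_sub_iff_add_le]
        exact (hadd P hP).symm.le.trans (hb ⟨P, hP, rfl⟩)
    · rw [← EReal.coe_mul]
      refine biSup_coe_eq_of_isLUB hne ⟨?_, fun b hb => ?_⟩
      · rintro _ ⟨P, hP, rfl⟩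
        change ∫ ω, l * X ω ∂P ≤ _
        rw [integral_const_mul]
        exact mul_le_mul_of_nonneg_left (hS.1 ⟨P, hP, rfl⟩) hl.le
      · rw [← le_div_iff₀' hl]
        refine hS.2 ?_
        rintro _ ⟨P, hP, rfl⟩
        rw [le_div_iff₀' hl]
        exact (integral_const_mul l X).symm.le.trans (hb ⟨P, hP, rfl⟩)
    · refine iSup₂_le fun P hP => ?_
      have := (hQ hP).1
      rw [← EReal.coe_add, EReal.coe_le_coe_iff,
        integral_add (hX.integrable P) (hY.integrable P)]
      exact add_le_add (hS.1 ⟨P, hP, rfl⟩) (hT.1 ⟨P, hP, rfl⟩)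
end
end

section
/- Let P and Q be atomless probability measures on a measurable space (Ω, 𝓕). Then for every x ∈ [0,1] there exists a measurable set A ∈ 𝓕 with P(A) = x and Q(A) = x. -/
open MeasureTheory Set

noncomputable section

/-- Two continuous degree-one lifts of circle maps, one of them strictly monotone, have a common
increment of every prescribed size. -/
theorem exists_common_increment_of_strictMono {f g : ℝ → ℝ} (hf : Continuous f)
    (hg : Continuous g) (hfm : StrictMono f) (hf1 : ∀ s, f (s + 1) = f s + 1)
    (hg1 : ∀ s, g (s + 1) = g s + 1) {x : ℝ} (hx : x ∈ Icc (0 : ℝ) 1) :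
    ∃ s ∈ Icc (0 : ℝ) 1, ∃ t ∈ Icc s (s + 1), f t = f s + x ∧ g t = g s + x := by
  have hfn : ∀ (n : ℤ) s, f (s + n) = f s + n := by
    intro n s
    have hp : Function.Periodic (fun s => f s - s) 1 := fun s => by
      simp only [hf1]; ring
    have := hp.int_mul n s
    simp only [mul_one] at this
    linarith
  have hsurj : Function.Surjective f := by
    intro y
    have h1 : f (⌊y - f 0⌋ : ℤ) ≤ y := by
      have := hfn ⌊y - f 0⌋ 0
      rw [zero_add] at this
      linarith [Int.floor_le (y - f 0)]
    have h2 : y ≤ f (⌈y - f 0⌉ : ℤ) := by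
      have := hfn ⌈y - f 0⌉ 0
      rw [zero_add] at this
      linarith [Int.le_ceil (y - f 0)]
    exact mem_range_of_exists_le_of_exists_ge hf ⟨_, h1⟩ ⟨_, h2⟩
  let e : ℝ ≃o ℝ := hfm.orderIsoOfSurjective f hsurj
  have hfe : ∀ y, f (e.symm y) = y :=
    StrictMono.orderIsoOfSurjective_self_symm_apply f hfm hsurj
  let b : ℝ → ℝ := fun s => e.symm (f s + x)
  have hb : Continuous b := e.symm.continuous.comp (hf.add continuous_const)
  have hfb : ∀ s, f (b s) = f s + x := fun s => hfe _
  let k : ℝ → ℝ := fun s => g s - f s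
  have hk : Continuous k := hg.sub hf
  have hkp : Function.Periodic k 1 := fun s => by
    simp only [k, hf1, hg1]; ring
  have hkmem : ∀ s, ∃ u ∈ Icc (0 : ℝ) 1, k s = k u := fun s => by
    obtain ⟨u, hu, h⟩ := hkp.exists_mem_Ico₀ one_pos s
    exact ⟨u, Ico_subset_Icc_self hu, h⟩
  obtain ⟨p, hp, hpmax⟩ := isCompact_Icc.exists_isMaxOn (nonempty_Icc.2 zero_le_one)
    (hk.continuousOn (s := Icc (0 : ℝ) 1))
  obtain ⟨q, hq, hqmin⟩ := isCompact_Icc.exists_isMinOn (nonempty_Icc.2 zero_le_one)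
    (hk.continuousOn (s := Icc (0 : ℝ) 1))
  have h1 : k (b p) - k p ≤ 0 := by
    obtain ⟨u, hu, h⟩ := hkmem (b p)
    have : k u ≤ k p := hpmax hu
    linarith
  have h2 : 0 ≤ k (b q) - k q := by
    obtain ⟨u, hu, h⟩ := hkmem (b q)
    have : k q ≤ k u := hqmin hu
    linarith
  obtain ⟨s, hs, hs0⟩ := isPreconnected_Icc.intermediate_value hp hq
    (((hk.comp hb).sub hk).continuousOn (s := Icc (0 : ℝ) 1)) ⟨h1, h2⟩
  refine ⟨s, hs, b s, ⟨?_, ?_⟩, hfb s, ?_⟩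
  · rw [← hfm.le_iff_le, hfb]; linarith [hx.1]
  · rw [← hfm.le_iff_le, hfb, hf1]; linarith [hx.2]
  · have := hfb s
    simp only [k, Pi.sub_apply, Function.comp_apply] at hs0
    linarith

/-- Two continuous monotone degree-one lifts of circle maps have a common increment of every
prescribed size. -/
theorem exists_common_increment {f g : ℝ → ℝ} (hf : Continuous f)
    (hg : Continuous g) (hfm : Monotone f) (hf1 : ∀ s, f (s + 1) = f s + 1)
    (hg1 : ∀ s, g (s + 1) = g s + 1) {x : ℝ} (hx : x ∈ Icc (0 : ℝ) 1) :
    ∃ s ∈ Icc (0 : ℝ) 1, ∃ t ∈ Icc s (s + 1), f t = f s + x ∧ g t = g s + x := by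
  let φ : ℝ × ℝ → ℝ := fun z =>
    |f (z.1 + z.2) - f z.1 - x| + |g (z.1 + z.2) - g z.1 - x|
  have hφ : Continuous φ := by fun_prop
  obtain ⟨⟨s, d⟩, ⟨hs, hd⟩, hmin⟩ :=
    ((isCompact_Icc (a := (0 : ℝ)) (b := 1)).prod
      (isCompact_Icc (a := (0 : ℝ)) (b := 1))).exists_isMinOn
      ⟨(0, 0), by simp⟩ hφ.continuousOn
  have hle : φ (s, d) ≤ 0 := by
    refine le_of_forall_pos_le_add fun ε hε => ?_
    let δ := min ε 1
    have hδ : 0 < δ := lt_min hε one_pos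
    have hδ1 : δ ≤ 1 := min_le_right _ _
    have hδε : δ ≤ ε := min_le_left _ _
    obtain ⟨u, hu, v, hv, hfuv, hguv⟩ := exists_common_increment_of_strictMono
      (f := fun s => (1 - δ) * f s + δ * s) (by fun_prop) hg
      (fun a b hab => by
        have h := mul_le_mul_of_nonneg_left (hfm hab.le) (sub_nonneg.2 hδ1)
        have h' := mul_lt_mul_of_pos_left hab hδ
        linarith)
      (fun s => by simp only [hf1]; ring) hg1 hx
    have hm : φ (s, d) ≤ φ (u, v - u) :=
      hmin ⟨hu, by simp only [mem_Icc] at hv ⊢; constructor <;> linarith⟩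
    have hlow := hfm hv.1
    have hupp := hfm hv.2
    rw [hf1] at hupp
    have hfx : |f v - f u - x| ≤ δ := by
      have : f v - f u - x = δ * ((f v - f u) - (v - u)) := by linarith
      rw [this, abs_mul, abs_of_pos hδ]
      refine mul_le_of_le_one_right hδ.le (abs_le.2 ⟨?_, ?_⟩) <;> linarith [hv.1, hv.2]
    have hval : φ (u, v - u) = |f v - f u - x| := by
      simp [φ, hguv]
    linarith
  have hA := abs_nonneg (f (s + d) - f s - x)
  have hB := abs_nonneg (g (s + d) - g s - x)
  simp only [φ] at hle
  refine ⟨s, hs, s + d, ⟨by linarith [hd.1], by linarith [hd.2]⟩, ?_, ?_⟩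
  · have := abs_eq_zero.1 (le_antisymm (by linarith) hA); linarith
  · have := abs_eq_zero.1 (le_antisymm (by linarith) hB); linarith

/-- The degree-one lift of a function `F` on `[0,1]`, normalised by `F 0 = 0` and `F 1 = 1`. -/
def degreeOneLift (F : ℝ → ℝ) (s : ℝ) : ℝ := ⌊s⌋ + F (Int.fract s)

theorem degreeOneLift_add_one (F : ℝ → ℝ) (s : ℝ) :
    degreeOneLift F (s + 1) = degreeOneLift F s + 1 := by
  simp only [degreeOneLift, Int.floor_add_one, Int.fract_add_one]
  push_cast
  ring

theorem degreeOneLift_of_mem_Icc {F : ℝ → ℝ} (h0 : F 0 = 0) (h1 : F 1 = 1) {s : ℝ}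
    (hs : s ∈ Icc (0 : ℝ) 1) : degreeOneLift F s = F s := by
  rcases hs.2.eq_or_lt with rfl | h
  · simp [degreeOneLift, h0, h1]
  · have hfl : ⌊s⌋ = 0 := Int.floor_eq_zero_iff.2 ⟨hs.1, h⟩
    simp [degreeOneLift, hfl, Int.fract_eq_self.2 ⟨hs.1, h⟩]

theorem continuous_degreeOneLift {F : ℝ → ℝ} (hF : Continuous F) (h0 : F 0 = 0) (h1 : F 1 = 1) :
    Continuous (degreeOneLift F) := by
  have h : Continuous ((fun s => F s - s) ∘ Int.fract) :=
    ContinuousOn.comp_fract'' (hF.sub continuous_id).continuousOn (by simp [h0, h1])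
  have heq : degreeOneLift F = fun s => s + ((fun s => F s - s) ∘ Int.fract) s := by
    ext s
    simp only [degreeOneLift, Function.comp_apply]
    linarith [Int.floor_add_fract s]
  rw [heq]
  exact continuous_id.add h

theorem monotone_degreeOneLift {F : ℝ → ℝ} (hF : Monotone F) (h0 : F 0 = 0) (h1 : F 1 = 1) :
    Monotone (degreeOneLift F) := by
  intro a b hab
  simp only [degreeOneLift]
  rcases (Int.floor_mono hab).eq_or_lt with h | h
  · rw [h]
    have : Int.fract a ≤ Int.fract b := by
      simp only [Int.fract, h]; linarith
    linarith [hF this]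
  · have h' : (⌊a⌋ : ℝ) + 1 ≤ ⌊b⌋ := by exact_mod_cast h
    have ha : F (Int.fract a) ≤ 1 := h1 ▸ hF (Int.fract_lt_one a).le
    have hb : 0 ≤ F (Int.fract b) := h0 ▸ hF (Int.fract_nonneg b)
    linarith

theorem continuous_cdf (μ : Measure ℝ) [IsProbabilityMeasure μ] [NullSingletonClass μ] :
    Continuous (ProbabilityTheory.cdf μ) := by
  rw [continuous_iff_continuousAt]
  intro a
  have h := (ProbabilityTheory.cdf μ).measure_singleton a
  rw [ProbabilityTheory.measure_cdf, measure_singleton, eq_comm, ENNReal.ofReal_eq_zero] at h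
  have hmono := ProbabilityTheory.monotone_cdf μ
  rw [hmono.continuousAt_iff_leftLim_eq_rightLim, StieltjesFunction.rightLim_eq]
  exact le_antisymm (hmono.leftLim_le le_rfl) (by linarith)

theorem cdf_zero_of_Icc (μ : Measure ℝ) [IsProbabilityMeasure μ] [NullSingletonClass μ]
    (h : ∀ᵐ y ∂μ, y ∈ Icc (0 : ℝ) 1) : ProbabilityTheory.cdf μ 0 = 0 := by
  have h0 : μ (Iic 0) = 0 := by
    refine measure_eq_zero_iff_ae_notMem.2 ?_
    filter_upwards [h, μ.ae_ne 0] with y hy hy0 hle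
    exact hy0 (le_antisymm hle hy.1)
  rw [ProbabilityTheory.cdf_eq_real, measureReal_def, h0, ENNReal.toReal_zero]

theorem cdf_one_of_Icc (μ : Measure ℝ) [IsProbabilityMeasure μ]
    (h : ∀ᵐ y ∂μ, y ∈ Icc (0 : ℝ) 1) : ProbabilityTheory.cdf μ 1 = 1 := by
  have h1 : μ (Iic 1) = 1 := by
    rw [← mem_ae_iff_prob_eq_one measurableSet_Iic]
    filter_upwards [h] with y hy using hy.2
  rw [ProbabilityTheory.cdf_eq_real, measureReal_def, h1, ENNReal.toReal_one]

/-- The probability of a half-open interval is the increment of the distribution function. -/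
theorem measure_Ioc_eq_cdf_sub (μ : Measure ℝ) [IsProbabilityMeasure μ] (a b : ℝ) :
    μ (Ioc a b) = ENNReal.ofReal (ProbabilityTheory.cdf μ b - ProbabilityTheory.cdf μ a) := by
  conv_lhs => rw [← ProbabilityTheory.measure_cdf μ]
  exact StieltjesFunction.measure_Ioc _ _ _

theorem exists_set_same_measure_of_Icc (μ ν : Measure ℝ) [IsProbabilityMeasure μ]
    [IsProbabilityMeasure ν] [NullSingletonClass μ] [NullSingletonClass ν]
    (hμ : ∀ᵐ y ∂μ, y ∈ Icc (0 : ℝ) 1) (hν : ∀ᵐ y ∂ν, y ∈ Icc (0 : ℝ) 1)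
    {x : ℝ} (hx : x ∈ Icc (0 : ℝ) 1) :
    ∃ A : Set ℝ, MeasurableSet A ∧ μ A = ENNReal.ofReal x ∧ ν A = ENNReal.ofReal x := by
  have hμ0 := cdf_zero_of_Icc μ hμ
  have hμ1 := cdf_one_of_Icc μ hμ
  have hν0 := cdf_zero_of_Icc ν hν
  have hν1 := cdf_one_of_Icc ν hν
  obtain ⟨s, hs, t, ht, hF, hG⟩ := exists_common_increment
    (continuous_degreeOneLift (continuous_cdf μ) hμ0 hμ1)
    (continuous_degreeOneLift (continuous_cdf ν) hν0 hν1)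
    (monotone_degreeOneLift (ProbabilityTheory.monotone_cdf μ) hμ0 hμ1)
    (degreeOneLift_add_one _) (degreeOneLift_add_one _) hx
  rw [degreeOneLift_of_mem_Icc hμ0 hμ1 hs] at hF
  rw [degreeOneLift_of_mem_Icc hν0 hν1 hs] at hG
  rcases le_or_gt t 1 with h | h
  · have htm : t ∈ Icc (0 : ℝ) 1 := ⟨hs.1.trans ht.1, h⟩
    rw [degreeOneLift_of_mem_Icc hμ0 hμ1 htm] at hF
    rw [degreeOneLift_of_mem_Icc hν0 hν1 htm] at hG
    refine ⟨Ioc s t, measurableSet_Ioc, ?_, ?_⟩ <;> rw [measure_Ioc_eq_cdf_sub]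
    · rw [hF, add_sub_cancel_left]
    · rw [hG, add_sub_cancel_left]
  · obtain ⟨r, rfl⟩ : ∃ r, t = r + 1 := ⟨t - 1, by ring⟩
    have hrm : r ∈ Icc (0 : ℝ) 1 := ⟨by linarith, by linarith [ht.2, hs.2]⟩
    rw [degreeOneLift_add_one, degreeOneLift_of_mem_Icc hμ0 hμ1 hrm] at hF
    rw [degreeOneLift_add_one, degreeOneLift_of_mem_Icc hν0 hν1 hrm] at hG
    have key : ∀ (ρ : Measure ℝ) [IsProbabilityMeasure ρ],
        ProbabilityTheory.cdf ρ r + 1 = ProbabilityTheory.cdf ρ s + x →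
        ρ (Ioc r s)ᶜ = ENNReal.ofReal x := by
      intro ρ _ h
      rw [prob_compl_eq_one_sub measurableSet_Ioc, measure_Ioc_eq_cdf_sub, ← ENNReal.ofReal_one,
        ← ENNReal.ofReal_sub _ (by linarith [hx.2])]
      congr 1
      linarith
    exact ⟨_, measurableSet_Ioc.compl, key μ hF, key ν hG⟩

theorem IsAtomlessProb.exists_nullSingleton {Ω : Type*} [MeasurableSpace Ω] {P : Measure Ω}
    (hP : IsAtomlessProb P) : ∃ U : Ω → ℝ, Measurable U ∧ ∀ c, P (U ⁻¹' {c}) = 0 := by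
  obtain ⟨-, U, hU, hmap⟩ := hP
  refine ⟨U, hU, fun c => ?_⟩
  rw [← Measure.map_apply hU (measurableSet_singleton c), hmap]
  simp [unif01]

/-- Lyapunov-type theorem: for two atomless probability measures and any `x ∈ [0,1]`,
there is a measurable set having measure `x` under both. -/
theorem exists_set_same_measure {Ω : Type*} [MeasurableSpace Ω]
    (P Q : Measure Ω) (hP : IsAtomlessProb P) (hQ : IsAtomlessProb Q)
    (x : ℝ) (hx : x ∈ Icc (0:ℝ) 1) :
    ∃ A : Set Ω, MeasurableSet A ∧ P A = ENNReal.ofReal x ∧ Q A = ENNReal.ofReal x := by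
  have := hP.1
  have := hQ.1
  obtain ⟨U, hU, hPU⟩ := hP.exists_nullSingleton
  obtain ⟨V, hV, hQV⟩ := hQ.exists_nullSingleton
  have hc : ¬ Countable (ℝ × ℝ) := by
    rw [not_countable_iff]; infer_instance
  have hcI : ¬ Countable unitInterval := by
    rw [unitInterval, Set.countable_coe_iff]
    exact Cardinal.Real.Icc_countable_iff.not.2 (by norm_num)
  let e : ℝ × ℝ ≃ᵐ unitInterval := PolishSpace.measurableEquivOfNotCountable hc hcI
  let W : Ω → ℝ := fun ω => e (U ω, V ω)
  have hW : Measurable W := measurable_subtype_coe.comp (e.measurable.comp (hU.prodMk hV))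
  have hWinj : ∀ {ω ω'}, W ω = W ω' → U ω = U ω' ∧ V ω = V ω' := fun h => by
    simpa using e.injective (Subtype.ext h)
  have hsing : ∀ (R : Measure Ω) (Z : Ω → ℝ), (∀ c, R (Z ⁻¹' {c}) = 0) →
      (∀ ω ω', W ω = W ω' → Z ω = Z ω') → NullSingletonClass (R.map W) := by
    refine fun R Z hZ hinj => ⟨fun c => ?_⟩
    rw [Measure.map_apply hW (measurableSet_singleton c)]
    rcases (W ⁻¹' {c}).eq_empty_or_nonempty with h | ⟨ω, hω⟩
    · rw [h, measure_empty]
    · exact measure_mono_null (fun ω' hω' => hinj ω' ω (hω'.trans hω.symm)) (hZ (Z ω))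
  have := hsing P U hPU fun _ _ h => (hWinj h).1
  have := hsing Q V hQV fun _ _ h => (hWinj h).2
  have := Measure.isProbabilityMeasure_map (μ := P) hW.aemeasurable
  have := Measure.isProbabilityMeasure_map (μ := Q) hW.aemeasurable
  have hmem : ∀ R : Measure Ω, ∀ᵐ y ∂(R.map W), y ∈ Icc (0 : ℝ) 1 := fun R =>
    (ae_map_iff hW.aemeasurable measurableSet_Icc).2 (ae_of_all _ fun ω => (e (U ω, V ω)).2)
  obtain ⟨A, hA, hPA, hQA⟩ :=
    exists_set_same_measure_of_Icc (P.map W) (Q.map W) (hmem P) (hmem Q) hx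
  refine ⟨W ⁻¹' A, hW hA, ?_, ?_⟩
  · rw [← Measure.map_apply hW hA, hPA]
  · rw [← Measure.map_apply hW hA, hQA]
end
end

section
/- Let P and Q be atomless probability measures on a measurable space (Ω, 𝓕) with P ≠ Q. Then for every ε ∈ (0, 1/2) there exists δ' > 0 such that for every x ∈ (ε, 1−ε) and every δ with |δ| < δ' there exists a measurable set A ∈ 𝓕 with P(A) = x + δ and Q(A) = x − δ. -/
open MeasureTheory Set

noncomputable section

open Filter Topology

theorem continuous_measureReal_Iic (l : Measure ℝ) [IsFiniteMeasure l] [NullSingletonClass l] :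
    Continuous fun x : ℝ => l.real (Iic x) := by
  have h (a : ℝ) : ContinuousOn (fun x : ℝ => l.real (Iic x)) (Iic a) := by
    have := IntegrableOn.continuousOn_Iic_primitive_Iic (μ := l) (f := fun _ => (1 : ℝ))
      (a₀ := a) (integrable_const _).integrableOn
    simpa using this
  exact continuous_iff_continuousAt.2 fun x =>
    (h (x + 1)).continuousAt (Iic_mem_nhds (by linarith))

theorem exists_isLowerSet_measureReal_eq (l : Measure ℝ) [IsFiniteMeasure l]
    [NullSingletonClass l] (t : ℝ) (ht : t ∈ Icc 0 (l.real univ)) :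
    ∃ s : Set ℝ, IsLowerSet s ∧ MeasurableSet s ∧ l.real s = t := by
  rcases ht.1.eq_or_lt with rfl | h0
  · exact ⟨∅, isLowerSet_empty, .empty, by simp⟩
  rcases ht.2.eq_or_lt with rfl | h1
  · exact ⟨univ, isLowerSet_univ, .univ, rfl⟩
  have hbot : ∃ x, l.real (Iic x) ≤ t := by
    have h := (ENNReal.tendsto_toReal (measure_ne_top l univ)).comp
      (tendsto_measure_Ici_atBot (μ := l))
    obtain ⟨x, hx⟩ := (h.eventually_const_lt (show l.real univ - t < l.real univ by linarith)).exists
    refine ⟨x, ?_⟩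
    have h2 : l.real (Iic x) = l.real (Iio x) := by
      simp only [Measure.real, measure_congr (Iio_ae_eq_Iic (μ := l) (a := x))]
    have h3 := measureReal_add_measureReal_compl (μ := l) (measurableSet_Ici (a := x))
    rw [compl_Ici] at h3
    change _ < l.real (Ici x) at hx
    linarith
  have htop : ∃ x, t ≤ l.real (Iic x) := by
    have h := (ENNReal.tendsto_toReal (measure_ne_top l univ)).comp
      (tendsto_measure_Iic_atTop (μ := l))
    obtain ⟨x, hx⟩ := (h.eventually_const_lt h1).exists
    exact ⟨x, hx.le⟩
  obtain ⟨x, hx⟩ := mem_range_of_exists_le_of_exists_ge (continuous_measureReal_Iic l) hbot htop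
  exact ⟨Iic x, isLowerSet_Iic x, measurableSet_Iic, hx⟩

/-- Two atomless finite measures on the line have a common bisecting set. -/
theorem exists_common_half_real (m n : Measure ℝ) [IsFiniteMeasure m] [IsFiniteMeasure n]
    [NullSingletonClass m] [NullSingletonClass n] :
    ∃ s : Set ℝ, MeasurableSet s ∧ m.real s = m.real univ / 2 ∧ n.real s = n.real univ / 2 := by
  have hl (s : Set ℝ) : (m + n).real s = m.real s + n.real s := measureReal_add_apply
  have : NullSingletonClass (m + n) := ⟨fun x => by simp⟩
  have key := exists_isLowerSet_measureReal_eq (m + n)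
  set M := (m + n).real univ with hM
  have hM0 : 0 ≤ M := measureReal_nonneg
  rcases hM0.eq_or_lt with h0 | hpos
  · have h1 : 0 ≤ m.real univ := measureReal_nonneg
    have h2 : 0 ≤ n.real univ := measureReal_nonneg
    have h3 := hl univ
    refine ⟨∅, .empty, ?_, ?_⟩ <;> rw [measureReal_empty] <;> linarith
  choose! A hlow hmeas hA using key
  have hlip {s t : ℝ} (hs : s ∈ Icc 0 M) (ht : t ∈ Icc 0 M) :
      |m.real (A s) - m.real (A t)| ≤ |s - t| := by
    have aux {s t : ℝ} (hs : s ∈ Icc 0 M) (ht : t ∈ Icc 0 M) (h : A s ⊆ A t) :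
        |m.real (A s) - m.real (A t)| ≤ |s - t| := by
      have h1 : m.real (A s) ≤ m.real (A t) := measureReal_mono h
      have h2 : n.real (A s) ≤ n.real (A t) := measureReal_mono h
      have h3 := hA s hs
      have h4 := hA t ht
      rw [hl] at h3 h4
      rw [abs_of_nonpos (by linarith), abs_of_nonpos (by linarith)]
      linarith
    rcases (hlow s hs).total (hlow t ht) with h | h
    · exact aux hs ht h
    · rw [abs_sub_comm, abs_sub_comm s]
      exact aux ht hs h
  have hcont : ContinuousOn (fun t => m.real (A t)) (Icc 0 M) := by
    refine (LipschitzOnWith.of_dist_le_mul (K := 1) fun s hs t ht => ?_).continuousOn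
    simpa [Real.dist_eq] using hlip hs ht
  have hmaps : MapsTo (fun t => t + M / 2) (Icc 0 (M / 2)) (Icc 0 M) := fun t ht =>
    ⟨by linarith [ht.1], by linarith [ht.2]⟩
  have hsub : Icc 0 (M / 2) ⊆ Icc 0 M := Icc_subset_Icc_right (by linarith)
  have hcont' : ContinuousOn (fun t => m.real (A (t + M / 2)) - m.real (A t)) (Icc 0 (M / 2)) :=
    (hcont.comp (by fun_prop) hmaps).sub (hcont.mono hsub)
  have hA0 : m.real (A 0) = 0 := by
    have h1 := hA 0 ⟨le_rfl, hM0⟩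
    rw [hl] at h1
    have h2 : 0 ≤ m.real (A 0) := measureReal_nonneg
    have h3 : 0 ≤ n.real (A 0) := measureReal_nonneg
    linarith
  have hAM : m.real (A M) = m.real univ := by
    have h1 := hA M ⟨hM0, le_rfl⟩
    have h0 := hl univ
    rw [hl] at h1
    have h2 : m.real (A M) ≤ m.real univ := measureReal_mono (subset_univ _)
    have h3 : n.real (A M) ≤ n.real univ := measureReal_mono (subset_univ _)
    linarith
  obtain ⟨t, ht, htm⟩ : ∃ t ∈ Icc 0 (M / 2),
      m.real (A (t + M / 2)) - m.real (A t) = m.real univ / 2 := by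
    have hl0 : (0 : ℝ) ∈ Icc 0 (M / 2) := ⟨le_rfl, by linarith⟩
    have hr0 : M / 2 ∈ Icc 0 (M / 2) := ⟨by linarith, le_rfl⟩
    rcases le_total (m.real (A (M / 2))) (m.real univ / 2) with h | h
    · refine isPreconnected_Icc.intermediate_value hl0 hr0 hcont' ⟨?_, ?_⟩
      · simpa [hA0] using h
      · simp only [add_halves, hAM]; linarith
    · refine isPreconnected_Icc.intermediate_value hr0 hl0 hcont' ⟨?_, ?_⟩
      · simp only [add_halves, hAM]; linarith
      · simpa [hA0] using h
  have hss : A t ⊆ A (t + M / 2) := by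
    rcases (hlow t (hsub ht)).total (hlow _ (hmaps ht)) with h | h
    · exact h
    · have h1 : (m + n).real (A (t + M / 2)) ≤ (m + n).real (A t) := measureReal_mono h
      rw [hA _ (hsub ht), hA _ (hmaps ht)] at h1
      linarith
  have hm := measureReal_sdiff (μ := m) hss (hmeas t (hsub ht))
  refine ⟨A (t + M / 2) \ A t, (hmeas _ (hmaps ht)).diff (hmeas _ (hsub ht)), by linarith, ?_⟩
  have hn := measureReal_sdiff (μ := n) hss (hmeas t (hsub ht))
  have h1 := hA _ (hsub ht)
  have h2 := hA _ (hmaps ht)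
  rw [hl] at h1 h2
  have h3 := hl univ
  linarith

section

variable {Ω : Type*} [MeasurableSpace Ω] {P Q : Measure Ω} [IsFiniteMeasure P] [IsFiniteMeasure Q]
  {W : Ω → ℝ}

theorem exists_common_half (hW : Measurable W) (hP : ∀ w, P (W ⁻¹' {w}) = 0)
    (hQ : ∀ w, Q (W ⁻¹' {w}) = 0) (R : Set Ω) (hR : MeasurableSet R) :
    ∃ B ⊆ R, MeasurableSet B ∧ P.real B = P.real R / 2 ∧ Q.real B = Q.real R / 2 := by
  have hnull (μ : Measure Ω) (hμ : ∀ w, μ (W ⁻¹' {w}) = 0) :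
      NullSingletonClass ((μ.restrict R).map W) := ⟨fun w => by
    rw [Measure.map_apply hW (measurableSet_singleton w)]
    exact Measure.restrict_le_self.absolutelyContinuous (hμ w)⟩
  have := hnull P hP
  have := hnull Q hQ
  obtain ⟨s, hs, h1, h2⟩ :=
    exists_common_half_real ((P.restrict R).map W) ((Q.restrict R).map W)
  refine ⟨W ⁻¹' s ∩ R, inter_subset_right, (hW hs).inter hR, ?_, ?_⟩
  · simpa [map_measureReal_apply hW, hs, measureReal_restrict_apply, hW hs] using h1
  · simpa [map_measureReal_apply hW, hs, measureReal_restrict_apply, hW hs] using h2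

/-- Two finite measures without atoms have a common subset of any given proportion. -/
theorem exists_common_proportion (hW : Measurable W) (hP : ∀ w, P (W ⁻¹' {w}) = 0)
    (hQ : ∀ w, Q (W ⁻¹' {w}) = 0) (D : Set Ω) (hD : MeasurableSet D) (t : ℝ) (ht : t ∈ Ico 0 1) :
    ∃ B ⊆ D, MeasurableSet B ∧ P.real B = t * P.real D ∧ Q.real B = t * Q.real D := by
  choose! f hsub hmeas hfP hfQ using exists_common_half hW hP hQ
  let R (k : ℕ) : Set Ω := f^[k] D
  have hR_succ (k : ℕ) : R (k + 1) = f (R k) := Function.iterate_succ_apply' f k D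
  have hRm (k : ℕ) : MeasurableSet (R k) := by
    induction k with
    | zero => exact hD
    | succ k ih => rw [hR_succ]; exact hmeas _ ih
  have hanti : Antitone R := antitone_nat_of_succ_le fun k => by
    rw [hR_succ]; exact hsub _ (hRm k)
  let C (k : ℕ) : Set Ω := R k \ R (k + 1)
  have hdisj : Pairwise (Function.onFun Disjoint C) :=
    pairwise_disjoint_on C |>.2 fun i j hij => Set.disjoint_left.2 fun x hx hx' =>
      hx.2 (hanti hij hx'.1)
  let S : Set ℕ := {k | Real.digits t 2 k = 1}
  let E (k : ℕ) : Set Ω := {x ∈ C k | k ∈ S}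
  have hE (k : ℕ) : E k ⊆ C k := fun x hx => hx.1
  have hEm (k : ℕ) : MeasurableSet (E k) := by
    exact ((hRm k).diff (hRm (k + 1))).inter (.const (k ∈ S))
  have hmass (μ : Measure Ω) [IsFiniteMeasure μ]
      (hf : ∀ R, MeasurableSet R → μ.real (f R) = μ.real R / 2) :
      μ.real (⋃ k, E k) = t * μ.real D := by
    have hRk (k : ℕ) : μ.real (R k) = μ.real D / 2 ^ k := by
      induction k with
      | zero => simp [R]
      | succ k ih => rw [hR_succ, hf _ (hRm k), ih]; ring
    have hCk (k : ℕ) : μ.real (C k) = ((2 : ℝ) ^ (k + 1))⁻¹ * μ.real D := by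
      rw [measureReal_sdiff (hanti k.le_succ) (hRm _), hRk, hRk, pow_succ]
      field_simp
      ring
    have hEk (k : ℕ) :
        μ.real (E k) = Real.ofDigitsTerm (Real.digits t 2) k * μ.real D := by
      by_cases hk : Real.digits t 2 k = 1
      · have : E k = C k := by ext; simp [E, S, hk]
        simp [this, hCk, Real.ofDigitsTerm, hk]
      · have : E k = ∅ := by ext; simp [E, S, hk]
        have h0 : Real.digits t 2 k = 0 := by
          generalize Real.digits t 2 k = d at hk ⊢
          revert d; decide
        simp [this, Real.ofDigitsTerm, h0]
    have h1 := (Real.hasSum_ofDigitsTerm_digits t (b := 2) (by norm_num) ht).mul_right (μ.real D)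
    rw [← h1.tsum_eq, Measure.real, measure_iUnion
      (fun i j hij => (hdisj hij).mono (hE i) (hE j)) hEm,
      ENNReal.tsum_toReal_eq fun _ => measure_ne_top _ _]
    exact tsum_congr hEk
  refine ⟨⋃ k, E k, iUnion_subset fun k x hx => hanti k.zero_le (hE k hx).1, .iUnion hEm,
    hmass P hfP, hmass Q hfQ⟩

end

theorem IsAtomlessProb.exists_measurable_preimage_singleton_null {Ω : Type*} [MeasurableSpace Ω]
    {P : Measure Ω} (hP : IsAtomlessProb P) :
    ∃ U : Ω → ℝ, Measurable U ∧ ∀ u, P (U ⁻¹' {u}) = 0 := by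
  obtain ⟨-, U, hU, hmap⟩ := hP
  refine ⟨U, hU, fun u => ?_⟩
  rw [← Measure.map_apply hU (measurableSet_singleton u), hmap, unif01]
  exact measure_singleton u

/-- Lyapunov-type "rectangle" theorem: for two distinct atomless probability measures
`P ≠ Q` and every `ε ∈ (0, 1/2)`, there is `δ' > 0` such that for every
`x ∈ (ε, 1-ε)` and every `δ` with `|δ| < δ'` there is a measurable set `A` with
`P(A) = x + δ` and `Q(A) = x - δ`. -/
theorem exists_rectangle_of_measures {Ω : Type*} [MeasurableSpace Ω]
    (P Q : Measure Ω) (hP : IsAtomlessProb P) (hQ : IsAtomlessProb Q) (hPQ : P ≠ Q)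
    (ε : ℝ) (hε : ε ∈ Ioo (0:ℝ) (1/2)) :
    ∃ δ' > (0:ℝ), ∀ x ∈ Ioo ε (1 - ε), ∀ δ : ℝ, |δ| < δ' →
      ∃ A : Set Ω, MeasurableSet A ∧
        P A = ENNReal.ofReal (x + δ) ∧ Q A = ENNReal.ofReal (x - δ) := by
  obtain ⟨U, hU, hU0⟩ := hP.exists_measurable_preimage_singleton_null
  obtain ⟨V, hV, hV0⟩ := hQ.exists_measurable_preimage_singleton_null
  have := hP.1
  have := hQ.1
  let W : Ω → ℝ := fun ω => embeddingReal (ℝ × ℝ) (U ω, V ω)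
  have he := measurableEmbedding_embeddingReal (ℝ × ℝ)
  have hW : Measurable W := he.measurable.comp (hU.prodMk hV)
  have hfiber (w : ℝ) : ∃ u v, W ⁻¹' {w} ⊆ U ⁻¹' {u} ∧ W ⁻¹' {w} ⊆ V ⁻¹' {v} := by
    rcases (W ⁻¹' {w}).eq_empty_or_nonempty with h | ⟨ω₀, h₀⟩
    · simp [h]
    · have h (ω) (hω : ω ∈ W ⁻¹' {w}) : (U ω, V ω) = (U ω₀, V ω₀) :=
        he.injective (hω.trans h₀.symm)
      exact ⟨U ω₀, V ω₀, fun ω hω => congrArg Prod.fst (h ω hω),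
        fun ω hω => congrArg Prod.snd (h ω hω)⟩
  have hWP (w : ℝ) : P (W ⁻¹' {w}) = 0 := by
    obtain ⟨u, _, h, _⟩ := hfiber w
    exact measure_mono_null h (hU0 u)
  have hWQ (w : ℝ) : Q (W ⁻¹' {w}) = 0 := by
    obtain ⟨_, v, _, h⟩ := hfiber w
    exact measure_mono_null h (hV0 v)
  obtain ⟨D, hD, hne⟩ : ∃ D, MeasurableSet D ∧ P.real D ≠ Q.real D := by
    by_contra! h
    exact hPQ (Measure.ext fun s hs => (measureReal_eq_measureReal_iff).1 (h s hs))
  have hp : P.real Dᶜ = 1 - P.real D := by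
    rw [measureReal_compl hD, probReal_univ]
  have hq : Q.real Dᶜ = 1 - Q.real D := by
    rw [measureReal_compl hD, probReal_univ]
  set p := P.real D
  set q := Q.real D
  have hpq : p - q ≠ 0 := sub_ne_zero.2 hne
  -- Solve `s p + t (1 - p) = x + δ`, `s q + t (1 - q) = x - δ` by `s = x + a δ`, `t = x + b δ`.
  obtain ⟨c, hc⟩ : ∃ c, c * (p - q) = 2 := ⟨2 / (p - q), div_mul_cancel₀ _ hpq⟩
  let b := 1 - p * c
  let a := b + c
  have hK : 0 < |a| + |b| + 1 := by positivity
  refine ⟨ε / (|a| + |b| + 1), div_pos hε.1 hK, fun x hx δ hδ => ?_⟩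
  rw [lt_div_iff₀ hK] at hδ
  have hmem (r : ℝ) (hr : |r| ≤ |a| + |b| + 1) : x + r * δ ∈ Ico (0 : ℝ) 1 := by
    have h : |r * δ| < ε := by
      rw [abs_mul, mul_comm]
      exact (mul_le_mul_of_nonneg_left hr (abs_nonneg δ)).trans_lt hδ
    have := abs_lt.1 h
    exact ⟨by linarith [hx.1], by linarith [hx.2]⟩
  obtain ⟨B, hBD, hB, hBP, hBQ⟩ := exists_common_proportion hW hWP hWQ D hD _
    (hmem a (by linarith [abs_nonneg b]))
  obtain ⟨B', hBD', hB', hBP', hBQ'⟩ := exists_common_proportion hW hWP hWQ Dᶜ hD.compl _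
    (hmem b (by linarith [abs_nonneg a]))
  have hdisj : Disjoint B B' := disjoint_compl_right.mono hBD hBD'
  have hPA : P.real (B ∪ B') = x + δ := by
    rw [measureReal_union hdisj hB', hBP, hBP', hp]
    simp only [a, b]
    ring
  have hQA : Q.real (B ∪ B') = x - δ := by
    rw [measureReal_union hdisj hB', hBQ, hBQ', hq]
    simp only [a, b]
    linear_combination (-δ) * hc
  exact ⟨B ∪ B', hB.union hB', by rw [← hPA, ofReal_measureReal],
    by rw [← hQA, ofReal_measureReal]⟩
end
end

section
/- Let Ψ be a generalized risk measure with Ψ(X|P) ∈ ℝ for every X ∈ 𝒳 and P ∈ 𝒫, where 𝒫 is nonempty. Then Ψ satisfies (A1) uncertainty aversion (Ψ(X|𝒬) ≤ Ψ(X|ℛ) whenever 𝒬 ⊆ ℛ), (A3) scenario upper bound (Ψ(X|𝒬) ≤ sup_{P∈𝒬} Ψ(X|P)), (B2) loss law invariance (Ψ(X|P) = Ψ(Y|P) whenever F_{X|P} = F_{Y|P}), and (B5) (if F_{X|P} = F_{Y|Q} and F_{Z|P} = F_{W|Q} then Ψ(X|P) − Ψ(Y|Q) = Ψ(Z|P)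 − Ψ(W|Q)) if and only if there exist a function γ : 𝒫 → ℝ and a function ψ : ℳ → ℝ such that Ψ(X|𝒬) = sup_{P∈𝒬} (ψ(F_{X|P}) − γ(P)) for all X ∈ 𝒳 and all nonempty 𝒬 ⊆ 𝒫. -/
open MeasureTheory Set

noncomputable section

open scoped unitInterval in
/-- A map that is uniform on `[0,1]` can be transformed to have any given law. -/
lemma IsAtomlessProb.exists_measurable_map_eq {Ω E : Type*} [MeasurableSpace Ω]
    [MeasurableSpace E] [StandardBorelSpace E] [Nonempty E] {Q : Measure Ω}
    (hQ : IsAtomlessProb Q) (μ : Measure E) [IsProbabilityMeasure μ] :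
    ∃ Y : Ω → E, Measurable Y ∧ Q.map Y = μ := by
  obtain ⟨-, U, hU, hQU⟩ := hQ
  obtain ⟨f, hf, hfμ⟩ := μ.exists_measurable_map_eq
  have hp : Measurable (projIcc (0 : ℝ) 1 zero_le_one) := continuous_projIcc.measurable
  have hvol : Measure.map (projIcc (0 : ℝ) 1 zero_le_one) unif01 = (volume : Measure I) := by
    have h : unif01 = (volume : Measure I).map (fun x : I => (x : ℝ)) :=
      unitInterval.measurePreserving_coe.map_eq.symm
    have hid : projIcc (0 : ℝ) 1 zero_le_one ∘ (fun x : I => (x : ℝ)) = id :=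
      funext fun x => projIcc_val zero_le_one x
    rw [h, Measure.map_map hp measurable_subtype_coe, hid, Measure.map_id]
  refine ⟨f ∘ projIcc (0 : ℝ) 1 zero_le_one ∘ U, hf.comp (hp.comp hU), ?_⟩
  rw [← Measure.map_map hf (hp.comp hU), ← Measure.map_map hp hU, hQU, hvol, hfμ]

/-- The law of a bounded random variable is attained by a bounded random variable under any
atomless probability measure. -/
lemma IsAtomlessProb.exists_bddMeas_map_eq {Ω Ω' : Type*} [MeasurableSpace Ω]
    [MeasurableSpace Ω'] {Q : Measure Ω} (hQ : IsAtomlessProb Q) (P : Measure Ω')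
    [IsProbabilityMeasure P] {X : Ω' → ℝ} (hX : BddMeas X) :
    ∃ Y : Ω → ℝ, BddMeas Y ∧ Q.map Y = P.map X := by
  obtain ⟨hXm, C, hC⟩ := hX
  have : IsProbabilityMeasure (P.map X) := Measure.isProbabilityMeasure_map hXm.aemeasurable
  obtain ⟨Y, hY, hQY⟩ := hQ.exists_measurable_map_eq (P.map X)
  have hclip : Measurable fun x : ℝ => max (-|C|) (min |C| x) := by fun_prop
  refine ⟨(fun x : ℝ => max (-|C|) (min |C| x)) ∘ Y, ⟨hclip.comp hY, |C|, fun ω => ?_⟩, ?_⟩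
  · exact abs_le.2 ⟨le_max_left _ _, max_le (neg_le_self (abs_nonneg C)) (min_le_left _ _)⟩
  · rw [← Measure.map_map hclip hY, hQY, Measure.map_map hclip hXm]
    congr 1
    funext ω
    obtain ⟨h₁, h₂⟩ := abs_le.1 ((hC ω).trans (le_abs_self C))
    simp [h₁, h₂]

/-- Proposition (robust representation): a generalized risk measure whose core is
real-valued satisfies (A1), (A3), (B2) and (B5) iff
`Ψ(X|𝒬) = sup_{P∈𝒬} (ψ(F_{X|P}) − γ(P))` for some real-valued `ψ` on distributions
and a real-valued penalty `γ` on scenarios. -/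
theorem robust_representation {Ω : Type*} [MeasurableSpace Ω]
    (hne : ∃ P : Measure Ω, IsAtomlessProb P)
    (Ψ : (Ω → ℝ) → Set (Measure Ω) → EReal)
    (hfin : ∀ X : Ω → ℝ, BddMeas X → ∀ P : Measure Ω, IsAtomlessProb P →
      ∃ r : ℝ, Ψ X {P} = (r : EReal)) :
    ((∀ X : Ω → ℝ, BddMeas X → ∀ 𝒬 ℛ : Set (Measure Ω), 𝒬.Nonempty → 𝒬 ⊆ ℛ →
        ℛ ⊆ {P | IsAtomlessProb P} → Ψ X 𝒬 ≤ Ψ X ℛ) ∧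
      (∀ X : Ω → ℝ, BddMeas X → ∀ 𝒬 : Set (Measure Ω), 𝒬.Nonempty →
        𝒬 ⊆ {P | IsAtomlessProb P} → Ψ X 𝒬 ≤ ⨆ P ∈ 𝒬, Ψ X {P}) ∧
      (∀ X Y : Ω → ℝ, BddMeas X → BddMeas Y → ∀ P : Measure Ω, IsAtomlessProb P →
        P.map X = P.map Y → Ψ X {P} = Ψ Y {P}) ∧
      (∀ X Y Z W : Ω → ℝ, BddMeas X → BddMeas Y → BddMeas Z → BddMeas W →
        ∀ P Q : Measure Ω, IsAtomlessProb P → IsAtomlessProb Q →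
        P.map X = Q.map Y → P.map Z = Q.map W →
        Ψ X {P} - Ψ Y {Q} = Ψ Z {P} - Ψ W {Q}))
    ↔
    (∃ (γ : Measure Ω → ℝ) (ψ : Measure ℝ → ℝ),
      ∀ X : Ω → ℝ, BddMeas X → ∀ 𝒬 : Set (Measure Ω), 𝒬.Nonempty →
        𝒬 ⊆ {P | IsAtomlessProb P} →
        Ψ X 𝒬 = ⨆ P ∈ 𝒬, ((ψ (P.map X) - γ P : ℝ) : EReal)) := by
  constructor
  · rintro ⟨hmono, hsup, -, hdiff⟩
    obtain ⟨P₀, hP₀⟩ := hne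
    have h0 : BddMeas (fun _ : Ω => (0 : ℝ)) := ⟨measurable_const, 0, by simp⟩
    choose! r hr using hfin
    classical
    let ψ : Measure ℝ → ℝ := fun μ =>
      if h : ∃ Y : Ω → ℝ, BddMeas Y ∧ P₀.map Y = μ then r h.choose P₀ else 0
    let γ : Measure Ω → ℝ := fun P => r (fun _ => 0) P₀ - r (fun _ => 0) P
    have key : ∀ X, BddMeas X → ∀ P, IsAtomlessProb P →
        Ψ X {P} = ((ψ (P.map X) - γ P : ℝ) : EReal) := by
      intro X hX P hP
      have := hP.1
      have := hP₀.1
      have hex := hP₀.exists_bddMeas_map_eq P hX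
      have hψ : ψ (P.map X) = r hex.choose P₀ := dif_pos hex
      obtain ⟨hY, hYX⟩ := hex.choose_spec
      have h := hdiff X hex.choose (fun _ => 0) (fun _ => 0) hX hY h0 h0 P P₀ hP hP₀ hYX.symm
        (by simp [Measure.map_const])
      rw [hr X hX P hP, hr _ hY P₀ hP₀, hr _ h0 P hP, hr _ h0 P₀ hP₀] at h
      norm_cast at h
      rw [hr X hX P hP, hψ]
      norm_cast
      simp only [γ]
      linarith
    refine ⟨γ, ψ, fun X hX 𝒬 hne h𝒬 => ?_⟩
    have hcongr : ⨆ P ∈ 𝒬, ((ψ (P.map X) - γ P : ℝ) : EReal) = ⨆ P ∈ 𝒬, Ψ X {P} :=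
      biSup_congr fun P hP => (key X hX P (h𝒬 hP)).symm
    rw [hcongr]
    exact (hsup X hX 𝒬 hne h𝒬).antisymm <| iSup₂_le fun P hP =>
      hmono X hX {P} 𝒬 (singleton_nonempty P) (singleton_subset_iff.2 hP) h𝒬
  · rintro ⟨γ, ψ, hrep⟩
    have key : ∀ X, BddMeas X → ∀ P, IsAtomlessProb P →
        Ψ X {P} = ((ψ (P.map X) - γ P : ℝ) : EReal) := by
      intro X hX P hP
      rw [hrep X hX {P} (singleton_nonempty P) (singleton_subset_iff.2 hP), iSup_singleton]
    refine ⟨fun X hX 𝒬 ℛ hne hsub hℛ => ?_, fun X hX 𝒬 hne h𝒬 => ?_,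
      fun X Y hX hY P hP hXY => ?_, fun X Y Z W hX hY hZ hW P Q hP hQ hXY hZW => ?_⟩
    · rw [hrep X hX 𝒬 hne (hsub.trans hℛ), hrep X hX ℛ (hne.mono hsub) hℛ]
      exact biSup_mono hsub
    · rw [hrep X hX 𝒬 hne h𝒬]
      exact iSup₂_mono fun P hP => (key X hX P (h𝒬 hP)).ge
    · rw [key X hX P hP, key Y hY P hP, hXY]
    · rw [key X hX P hP, key Y hY Q hQ, key Z hZ P hP, key W hW Q hQ, hXY, hZW]
      simp only [← EReal.coe_sub, sub_sub_sub_cancel_left]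
end
end

section
/- Fix α ∈ (0,1). On Ω = [0,1] with its Borel σ-algebra, the Value-at-Risk is neither convex nor concave in the probability measure: there exist atomless probability measures P, Q, a bounded Borel measurable X : [0,1] → ℝ, and λ ∈ (0,1) with VaR_α(X | λP + (1−λ)Q) > λ VaR_α(X|P) + (1−λ) VaR_α(X|Q); and there exist atomless probability measures P', Q', a bounded Borel measurable X' : [0,1] → ℝ, and λ' ∈ (0,1) with VaR_α(X' | λ'P' + (1−λ')Q') < λ' VaR_α(X'|P') + (1−λ') VaR_α(X'|Q'). -/
open MeasureTheory Set

noncomputable section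

/-- The convex combination `λ P + (1-λ) Q` of two measures. -/
def mixM {Ω : Type*} [MeasurableSpace Ω] (l : ℝ) (P Q : Measure Ω) : Measure Ω :=
  ENNReal.ofReal l • P + ENNReal.ofReal (1 - l) • Q

/-- Value-at-Risk at level `α` of `X` under `P`. -/
def VaR {Ω : Type*} [MeasurableSpace Ω] (α : ℝ) (X : Ω → ℝ) (P : Measure Ω) : ℝ :=
  sInf {x : ℝ | ENNReal.ofReal α ≤ P {ω | X ω ≤ x}}

theorem setOf_indicator_one_le {Ω : Type*} (S : Set Ω) (x : ℝ) :
    {ω | S.indicator (1 : Ω → ℝ) ω ≤ x} = if x < 0 then ∅ else if x < 1 then Sᶜ else univ := by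
  classical
  ext ω
  split_ifs <;> by_cases hω : ω ∈ S <;> simp [hω] <;> linarith

theorem VaR_indicator_eq_zero {Ω : Type*} [MeasurableSpace Ω] {P : Measure Ω} {α : ℝ} (hα : 0 < α)
    {S : Set Ω} (h : ENNReal.ofReal α ≤ P Sᶜ) : VaR α (S.indicator 1) P = 0 := by
  refine IsLeast.csInf_eq ⟨?_, fun x hx => ?_⟩
  · rw [mem_ofPred_eq, setOf_indicator_one_le]
    simpa using h
  · by_contra! hx0
    rw [mem_ofPred_eq, setOf_indicator_one_le, if_pos hx0, measure_empty] at hx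
    exact absurd hx (by simpa using hα)

theorem VaR_indicator_eq_one {Ω : Type*} [MeasurableSpace Ω] {P : Measure Ω} {α : ℝ}
    {S : Set Ω} (h : P Sᶜ < ENNReal.ofReal α) (h1 : ENNReal.ofReal α ≤ P univ) :
    VaR α (S.indicator 1) P = 1 := by
  refine IsLeast.csInf_eq ⟨?_, fun x hx => ?_⟩
  · rw [mem_ofPred_eq, setOf_indicator_one_le]
    simpa [(zero_lt_one (α := ℝ)).not_gt] using h1
  · by_contra! hx1
    rw [mem_ofPred_eq, setOf_indicator_one_le, if_pos hx1] at hx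
    split_ifs at hx
    · exact absurd (hx.trans (measure_mono (empty_subset Sᶜ))) h.not_ge
    · exact absurd hx h.not_ge

theorem bddMeas_indicator_one_s19 {Ω : Type*} [MeasurableSpace Ω] {S : Set Ω} (hS : MeasurableSet S) :
    BddMeas (S.indicator (1 : Ω → ℝ)) := by
  refine ⟨measurable_one.indicator hS, 1, fun ω => ?_⟩
  by_cases hω : ω ∈ S <;> simp [hω]

instance : IsProbabilityMeasure unif01 := ⟨by simp [unif01]⟩

/-- A measurable map with an almost everywhere left inverse pushes the uniform distribution to an
atomless probability measure. -/
theorem isAtomlessProb_map_unif01 {Ω : Type*} [MeasurableSpace Ω] {f : ℝ → Ω} {U : Ω → ℝ}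
    (hf : Measurable f) (hU : Measurable U) (h : ∀ x ∈ Icc (0:ℝ) 1, U (f x) = x) :
    IsAtomlessProb (unif01.map f) := by
  refine ⟨Measure.isProbabilityMeasure_map hf.aemeasurable, U, hU, ?_⟩
  rw [Measure.map_map hU hf]
  have hid : U ∘ f =ᵐ[unif01] id := by
    filter_upwards [ae_restrict_mem measurableSet_Icc] with x hx using h x hx
  rw [Measure.map_congr hid, Measure.map_id]

/-- There are two mutually singular atomless probability measures on `[0,1]`. -/
theorem exists_isAtomlessProb_separated :
    ∃ (P Q : Measure (Icc (0:ℝ) 1)) (S : Set (Icc (0:ℝ) 1)), IsAtomlessProb P ∧ IsAtomlessProb Q ∧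
      MeasurableSet S ∧ P Sᶜ = 1 ∧ Q Sᶜ = 0 := by
  have hf : Measurable fun x : ℝ => projIcc (0:ℝ) 1 zero_le_one (x / 2) :=
    continuous_projIcc.measurable.comp (by fun_prop)
  have hg : Measurable fun x : ℝ => projIcc (0:ℝ) 1 zero_le_one ((x + 1) / 2) :=
    continuous_projIcc.measurable.comp (by fun_prop)
  have hfv : ∀ x ∈ Icc (0:ℝ) 1, (projIcc (0:ℝ) 1 zero_le_one (x / 2) : ℝ) = x / 2 :=
    fun x hx => by rw [projIcc_of_mem _ ⟨by linarith [hx.1], by linarith [hx.2]⟩]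
  have hgv : ∀ x ∈ Icc (0:ℝ) 1, (projIcc (0:ℝ) 1 zero_le_one ((x + 1) / 2) : ℝ) = (x + 1) / 2 :=
    fun x hx => by rw [projIcc_of_mem _ ⟨by linarith [hx.1], by linarith [hx.2]⟩]
  have hS : MeasurableSet {ω : Icc (0:ℝ) 1 | 1 / 2 < (ω : ℝ)} :=
    measurableSet_lt measurable_const measurable_subtype_coe
  have hP := isAtomlessProb_map_unif01 (U := fun ω : Icc (0:ℝ) 1 => 2 * (ω : ℝ)) hf (by fun_prop)
    fun x hx => by rw [hfv x hx]; ring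
  refine ⟨_, _, _, hP,
    isAtomlessProb_map_unif01 (U := fun ω : Icc (0:ℝ) 1 => 2 * (ω : ℝ) - 1) hg (by fun_prop)
      fun x hx => by rw [hgv x hx]; ring, hS, ?_, ?_⟩
  · have := hP.1
    rw [prob_compl_eq_one_iff hS, Measure.map_apply hf hS, measure_eq_zero_iff_ae_notMem]
    filter_upwards [ae_restrict_mem measurableSet_Icc] with x hx
    rw [mem_preimage, mem_ofPred_eq, hfv x hx]
    linarith [hx.2]
  · rw [Measure.map_apply hg hS.compl, measure_eq_zero_iff_ae_notMem]
    have h0 : ∀ᵐ x ∂unif01, x ≠ 0 := ae_restrict_of_ae (Measure.ae_ne volume 0)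
    filter_upwards [ae_restrict_mem measurableSet_Icc, h0] with x hx hx0
    rw [mem_preimage, mem_compl_iff, mem_ofPred_eq, hgv x hx, not_not]
    linarith [lt_of_le_of_ne hx.1 hx0.symm]

/-- On `Ω = [0,1]` with its Borel σ-algebra, Value-at-Risk is neither convex nor
concave in the probability measure. -/
theorem VaR_neither_convex_nor_concave_in_measure (α : ℝ) (hα : α ∈ Ioo (0:ℝ) 1) :
    (∃ (P Q : Measure (Icc (0:ℝ) 1)) (X : Icc (0:ℝ) 1 → ℝ) (l : ℝ),
      IsAtomlessProb P ∧ IsAtomlessProb Q ∧ BddMeas X ∧ l ∈ Ioo (0:ℝ) 1 ∧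
      l * VaR α X P + (1 - l) * VaR α X Q < VaR α X (mixM l P Q)) ∧
    (∃ (P' Q' : Measure (Icc (0:ℝ) 1)) (X' : Icc (0:ℝ) 1 → ℝ) (l' : ℝ),
      IsAtomlessProb P' ∧ IsAtomlessProb Q' ∧ BddMeas X' ∧ l' ∈ Ioo (0:ℝ) 1 ∧
      VaR α X' (mixM l' P' Q') < l' * VaR α X' P' + (1 - l') * VaR α X' Q') := by
  obtain ⟨hα0, hα1⟩ := hα
  obtain ⟨P, Q, S, hP, hQ, hS, hPS, hQS⟩ := exists_isAtomlessProb_separated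
  have := hP.1
  have := hQ.1
  have hα1' : ENNReal.ofReal α ≤ 1 := ENNReal.ofReal_le_one.2 hα1.le
  have hmix (l : ℝ) : mixM l P Q Sᶜ = ENNReal.ofReal l := by simp [mixM, hPS, hQS]
  have hVP : VaR α (S.indicator 1) P = 0 := VaR_indicator_eq_zero hα0 (hPS ▸ hα1')
  have hVQ : VaR α (S.indicator 1) Q = 1 :=
    VaR_indicator_eq_one (by rw [hQS]; exact ENNReal.ofReal_pos.2 hα0) (by simpa using hα1.le)
  refine ⟨⟨P, Q, S.indicator 1, α / 2, hP, hQ, bddMeas_indicator_one_s19 hS,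
      ⟨by linarith, by linarith⟩, ?_⟩,
    ⟨P, Q, S.indicator 1, (1 + α) / 2, hP, hQ, bddMeas_indicator_one_s19 hS,
      ⟨by linarith, by linarith⟩, ?_⟩⟩
  · have huniv : mixM (α / 2) P Q univ = 1 := by
      simp only [mixM, Measure.add_apply, Measure.smul_apply, measure_univ, smul_eq_mul, mul_one]
      rw [← ENNReal.ofReal_add (by linarith) (by linarith)]
      simp
    rw [hVP, hVQ, VaR_indicator_eq_one _ (huniv ▸ hα1')]
    · linarith
    · rw [hmix]
      exact (ENNReal.ofReal_lt_ofReal_iff hα0).2 (by linarith)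
  · rw [hVP, hVQ, VaR_indicator_eq_zero hα0]
    · linarith
    · rw [hmix]
      exact ENNReal.ofReal_le_ofReal (by linarith)
end
end
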